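/- arXiv:1308.2830 — 6 statements merged into one kernel-verified Lean document; each statement's English description precedes it below -/
import Mathlib

section
/- Let M > 0. Under Assumptions A1, A2 and A3 (with this M), the polynomial-type large deviation inequality with exponent M holds: sup_{r>0} r^M · sup_{n∈ℕ} P₀[ sup{ Z_n(u) : u ∈ U_n(θ₀), |u| > r } ≥ e^{−r} ] < ∞. -/
open MeasureTheory Filter Topology
open scoped ENNReal NNReal

/-- For an arbitrary function `h` there is a countable `D ⊆ s` such that every upper bound over `D`
of a function of `(x, h x)` that is continuous on `s ×ˢ univ` is an upper bound over `s`. -/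
theorem exists_countable_subset_forall_le_of_continuousOn_graph
    {E F : Type*} [PseudoEMetricSpace E] [SecondCountableTopology E]
    [PseudoEMetricSpace F] [SecondCountableTopology F] (s : Set E) (h : E → F) :
    ∃ D ⊆ s, D.Countable ∧ ∀ (φ : E × F → ℝ≥0∞), ContinuousOn φ (s ×ˢ Set.univ) →
      ∀ v : ℝ≥0∞, (∀ x ∈ D, φ (x, h x) ≤ v) → ∀ x ∈ s, φ (x, h x) ≤ v := by
  obtain ⟨c, hcs, hc, hcd⟩ := (TopologicalSpace.IsSeparable.of_separableSpace
    ((fun x => (x, h x)) '' s)).exists_countable_dense_subset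
  have hinj : Function.Injective fun x => (x, h x) := fun x y hxy => congrArg Prod.fst hxy
  refine ⟨s ∩ (fun x => (x, h x)) ⁻¹' c, Set.inter_subset_left,
    (hc.preimage hinj).mono Set.inter_subset_right, ?_⟩
  intro φ hφ v hv x hx
  have hcl : (x, h x) ∈ closure c := hcd ⟨x, hx, rfl⟩
  have hsub : c ⊆ s ×ˢ Set.univ := by
    intro z hz
    obtain ⟨y, hy, rfl⟩ := hcs hz
    exact ⟨hy, trivial⟩
  have hcont : ContinuousWithinAt φ c (x, h x) := (hφ _ ⟨hx, trivial⟩).mono hsub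
  have : (𝓝[c] (x, h x)).NeBot := mem_closure_iff_nhdsWithin_neBot.1 hcl
  refine le_of_tendsto hcont ?_
  filter_upwards [self_mem_nhdsWithin] with z hz
  obtain ⟨y, hy, rfl⟩ := hcs hz
  exact hv y ⟨hy, hz⟩

/-- A uniform `q`-th moment bound for `sup_{θ ∈ s} ‖a (b g(θ) - h(θ))‖`, with `g` random and a.s.
continuous and `h` nonrandom, gives the Markov inequality for the supremum. -/
theorem exists_ae_bound_and_meas_ge_le_div
    {E F Ω : Type*} [PseudoEMetricSpace E] [SecondCountableTopology E] [MeasurableSpace E]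
    [NormedAddCommGroup F] [NormedSpace ℝ F] [SecondCountableTopology F] [MeasurableSpace F]
    [BorelSpace F] [MeasurableSpace Ω] (μ : Measure Ω) {s : Set E} {g : Ω → E → F} {h : E → F}
    (hg : Measurable (Function.uncurry g)) (hgc : ∀ᵐ ω ∂μ, ContinuousOn (g ω) s)
    (a b : ℝ) (q : ℝ) {C : ℝ≥0∞}
    (hC : ∫⁻ ω, ⨆ θ ∈ s, ((‖a • (b • g ω θ - h θ)‖₊ : ℝ≥0∞) ^ q) ∂μ ≤ C) :
    ∃ S : Ω → ℝ≥0∞,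
      (∀ᵐ ω ∂μ, ∀ θ ∈ s, ((‖a • (b • g ω θ - h θ)‖₊ : ℝ≥0∞) ^ q) ≤ S ω) ∧
      ∀ t : ℝ≥0∞, t ≠ 0 → t ≠ ⊤ → μ {ω | t ≤ S ω} ≤ C / t := by
  obtain ⟨D, hDs, hD, hbd⟩ := exists_countable_subset_forall_le_of_continuousOn_graph s h
  refine ⟨fun ω => ⨆ θ ∈ D, ((‖a • (b • g ω θ - h θ)‖₊ : ℝ≥0∞) ^ q), ?_, ?_⟩
  · filter_upwards [hgc] with ω hω
    refine hbd (fun z => ((‖a • (b • g ω z.1 - z.2)‖₊ : ℝ≥0∞) ^ q)) ?_ _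
      fun x hx => le_iSup₂ (f := fun θ (_ : θ ∈ D) =>
        ((‖a • (b • g ω θ - h θ)‖₊ : ℝ≥0∞) ^ q)) x hx
    have h1 : ContinuousOn (fun z : E × F => a • (b • g ω z.1 - z.2)) (s ×ˢ Set.univ) :=
      (((hω.comp continuousOn_fst fun z hz => hz.1).const_smul b).sub
        continuousOn_snd).const_smul a
    exact (ENNReal.continuous_rpow_const.comp
      (ENNReal.continuous_coe.comp continuous_nnnorm)).comp_continuousOn h1
  · intro t ht ht'
    have hmeas : Measurable fun ω => ⨆ θ ∈ D, ((‖a • (b • g ω θ - h θ)‖₊ : ℝ≥0∞) ^ q) := by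
      refine Measurable.biSup D hD fun θ _ => ?_
      have hgθ : Measurable fun ω => g ω θ := hg.comp (measurable_id.prodMk measurable_const)
      have hR : Measurable fun ω => a • (b • g ω θ - h θ) :=
        ((hgθ.const_smul b).sub_const (h θ)).const_smul a
      exact (measurable_coe_nnreal_ennreal.comp hR.nnnorm).pow_const q
    refine (meas_ge_le_lintegral_div hmeas.aemeasurable ht ht').trans ?_
    gcongr
    exact (lintegral_mono fun ω => biSup_mono fun θ hθ => hDs hθ).trans hC

/-- If `‖z‖² ≥ χ r²` with `r` large, `y` is within `√χ r / 4` of `z` and `y₀` is within `√χ r / 4`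
of `0`, then `‖y‖²` exceeds `‖y₀‖²` by more than `r + 1`. -/
theorem add_one_lt_sq_sub_sq_of_norm_lt {F : Type*} [NormedAddCommGroup F]
    {y y₀ z : F} {χ r : ℝ} (hχ : 0 < χ) (hr : 1 ≤ r) (hr' : 4 / χ ≤ r)
    (hz : χ * r ^ 2 ≤ ‖z‖ ^ 2) (hy : ‖y - z‖ < √χ / 4 * r) (hy₀ : ‖y₀‖ < √χ / 4 * r) :
    r + 1 < ‖y‖ ^ 2 - ‖y₀‖ ^ 2 := by
  have hs : 0 < √χ := Real.sqrt_pos.2 hχ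
  have hsq : √χ ^ 2 = χ := Real.sq_sqrt hχ.le
  have hz' : √χ * r ≤ ‖z‖ := by
    refine abs_le_of_sq_le_sq' ?_ (norm_nonneg z) |>.2
    rw [mul_pow, hsq]
    exact hz
  have h1 : ‖z‖ ≤ ‖y‖ + ‖y - z‖ := by
    simpa using norm_sub_le y (y - z)
  have h2 : 3 * (√χ / 4 * r) < ‖y‖ := by linarith
  have hc : 0 < √χ / 4 * r := by positivity
  have h3 : (3 * (√χ / 4 * r)) ^ 2 < ‖y‖ ^ 2 := by gcongr
  have h4 : ‖y₀‖ ^ 2 < (√χ / 4 * r) ^ 2 := by gcongr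
  have h5 : 4 ≤ χ * r := by rwa [div_le_iff₀' hχ] at hr'
  have h6 : (√χ / 4 * r) ^ 2 = χ * r * r / 16 := by
    rw [mul_pow, div_pow, hsq]; ring
  have h7 : 4 * r ≤ χ * r * r := by gcongr
  rw [mul_pow, h6] at h3
  rw [h6] at h4
  linarith

/-- polynomial-type large deviation inequality (PLDI) for the Gaussian
quasi-likelihood random fields, under Assumptions A1, A2 and A3. -/
theorem stmt0
    (p : ℕ) (Θ : Set (EuclideanSpace ℝ (Fin p)))
    (hΘo : IsOpen Θ) (hΘb : Bornology.IsBounded Θ) (hΘconv : Convex ℝ Θ) (hΘne : Θ.Nonempty)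
    (θ₀ : EuclideanSpace ℝ (Fin p)) (hθ₀ : θ₀ ∈ Θ)
    (X : ℕ → Type) [∀ n, MeasurableSpace (X n)]
    (P : ∀ n, Measure (X n)) [∀ n, IsProbabilityMeasure (P n)]
    (T : ℕ → ℝ) (hTpos : ∀ n, 0 < T n) (hTtop : Tendsto T atTop atTop)
    (G : ∀ n, X n → EuclideanSpace ℝ (Fin p) → EuclideanSpace ℝ (Fin p))
    (hGmeas : ∀ n, Measurable (Function.uncurry (G n)))
    (M : ℝ) (hM : 0 < M)
    -- Assumption A1 (smoothness)
    (hA1 : ∀ n, ∀ᵐ ω ∂ P n, ContDiffOn ℝ 3 (G n ω) Θ ∧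
      ∃ Gext : EuclideanSpace ℝ (Fin p) → EuclideanSpace ℝ (Fin p),
        ContinuousOn Gext (closure Θ) ∧ Set.EqOn Gext (G n ω) Θ)
    -- Assumption A2 (bounded moments)
    (hA2a : ∀ K : ℝ, 0 < K → ∃ C : ℝ≥0∞, C ≠ ⊤ ∧ ∀ n,
      ∫⁻ ω, (‖(Real.sqrt (T n))⁻¹ • G n ω θ₀‖₊ : ℝ≥0∞) ^ K ∂ P n ≤ C)
    (hA2b : ∀ K : ℝ, 0 < K → ∀ k : ℕ, k ≤ 3 → ∃ C : ℝ≥0∞, C ≠ ⊤ ∧ ∀ n,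
      ∫⁻ ω, ⨆ θ ∈ Θ,
        ((‖(T n)⁻¹ • iteratedFDerivWithin ℝ k (G n ω) Θ θ‖₊ : ℝ≥0∞) ^ K) ∂ P n ≤ C)
    -- Assumption A3(a) (limits: identifiability)
    (Glim : EuclideanSpace ℝ (Fin p) → EuclideanSpace ℝ (Fin p))
    (hGlim0 : Glim θ₀ = 0)
    (hGlimbdd : ∃ Cb : ℝ, ∀ θ ∈ Θ, ‖Glim θ‖ ≤ Cb)
    (χ : ℝ) (hχ : 0 < χ)
    (hident : ∀ θ ∈ Θ, χ * ‖θ - θ₀‖ ^ 2 ≤ ‖Glim θ‖ ^ 2)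
    (ε : ℝ) (hε : 0 < ε)
    (hA3a : ∃ C : ℝ≥0∞, C ≠ ⊤ ∧ ∀ n,
      ∫⁻ ω, ⨆ θ ∈ Θ,
        ((‖Real.sqrt (T n) • ((T n)⁻¹ • G n ω θ - Glim θ)‖₊ : ℝ≥0∞) ^ (M + ε)) ∂ P n ≤ C)
    -- Assumption A3(b) (limits: nondegeneracy)
    (G' : EuclideanSpace ℝ (Fin p) →L[ℝ] EuclideanSpace ℝ (Fin p))
    (hG'rank : Function.Bijective G')
    (hA3b : ∃ C : ℝ≥0∞, C ≠ ⊤ ∧ ∀ n,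
      ∫⁻ ω, ((‖Real.sqrt (T n) •
          ((T n)⁻¹ • fderivWithin ℝ (G n ω) Θ θ₀ - G')‖₊ : ℝ≥0∞) ^ M) ∂ P n ≤ C) :
    -- PLDI
    ∃ C : ℝ, ∀ r : ℝ, 0 < r → ∀ n,
      r ^ M * (P n {ω | Real.exp (-r) ≤
        sSup {zv : ℝ | ∃ u : EuclideanSpace ℝ (Fin p),
          θ₀ + (Real.sqrt (T n))⁻¹ • u ∈ Θ ∧ r < ‖u‖ ∧
          zv = Real.exp ((-(T n)⁻¹ * ‖G n ω (θ₀ + (Real.sqrt (T n))⁻¹ • u)‖ ^ 2) -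
                (-(T n)⁻¹ * ‖G n ω θ₀‖ ^ 2))}}).toReal ≤ C := by
  obtain ⟨C, hC, hCb⟩ := hA3a
  have hq : 0 < M + ε := by positivity
  set R₀ : ℝ := max 1 (4 / χ)
  refine ⟨max (R₀ ^ M) (C.toReal / (√χ / 4) ^ (M + ε)), fun r hr n => ?_⟩
  rcases le_total r R₀ with hrR | hrR
  · refine le_trans ?_ (le_max_left _ _)
    calc _ ≤ r ^ M * 1 := by
          gcongr
          exact measureReal_le_one
      _ ≤ R₀ ^ M := by rw [mul_one]; gcongr
  refine le_trans ?_ (le_max_right _ _)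
  have hr1 : 1 ≤ r := (le_max_left _ _).trans hrR
  have hr4 : 4 / χ ≤ r := (le_max_right _ _).trans hrR
  have hcr : 0 < √χ / 4 * r := by positivity
  have hT := hTpos n
  have hsT : 0 < √(T n) := Real.sqrt_pos.2 hT
  have hsT2 : √(T n) ^ 2 = T n := Real.sq_sqrt hT.le
  have hTinv : √(T n) * (T n)⁻¹ = (√(T n))⁻¹ := by
    rw [← div_eq_mul_inv, Real.sqrt_div_self]
  obtain ⟨S, hSbd, hS⟩ := exists_ae_bound_and_meas_ge_le_div (P n) (hGmeas n)
    ((hA1 n).mono fun ω hω => hω.1.continuousOn) _ _ _ (hCb n)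
  set t : ℝ := (√χ / 4 * r) ^ (M + ε) with ht
  have htpos : 0 < t := Real.rpow_pos_of_pos hcr _
  have hprob := hS (ENNReal.ofReal t) (by simpa using htpos) ENNReal.ofReal_ne_top
  have hae := measure_mono_ae (μ := P n) (s := {ω | Real.exp (-r) ≤
        sSup {zv : ℝ | ∃ u : EuclideanSpace ℝ (Fin p),
          θ₀ + (Real.sqrt (T n))⁻¹ • u ∈ Θ ∧ r < ‖u‖ ∧
          zv = Real.exp ((-(T n)⁻¹ * ‖G n ω (θ₀ + (Real.sqrt (T n))⁻¹ • u)‖ ^ 2) -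
                (-(T n)⁻¹ * ‖G n ω θ₀‖ ^ 2))}}) (t := {ω | ENNReal.ofReal t ≤ S ω}) ?_
  · have hfin := ENNReal.toReal_mono (ENNReal.div_ne_top hC (by simpa using htpos))
      (hae.trans hprob)
    rw [ENNReal.toReal_div, ENNReal.toReal_ofReal htpos.le] at hfin
    calc _ ≤ r ^ M * (C.toReal / t) := by gcongr
      _ ≤ r ^ (M + ε) * (C.toReal / t) := by
          have hle := Real.rpow_le_rpow_of_exponent_le hr1 (le_add_of_nonneg_right hε.le : M ≤ M + ε)
          gcongr
      _ = C.toReal / (√χ / 4) ^ (M + ε) := by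
          rw [ht, Real.mul_rpow (by positivity) hr.le]
          have := (Real.rpow_pos_of_pos hr (M + ε)).ne'
          have := (Real.rpow_pos_of_pos (by positivity : 0 < √χ / 4) (M + ε)).ne'
          field_simp
  filter_upwards [hSbd] with ω hω hev
  change Real.exp (-r) ≤ sSup _ at hev
  change ENNReal.ofReal t ≤ S ω
  by_contra! hlt
  have hdev : ∀ θ ∈ Θ, ‖(√(T n))⁻¹ • G n ω θ - √(T n) • Glim θ‖ < √χ / 4 * r := by
    intro θ hθ
    have h1 := (hω θ hθ).trans_lt hlt
    rw [ht, ← ENNReal.ofReal_rpow_of_pos hcr, ENNReal.rpow_lt_rpow_iff hq, ← enorm_eq_nnnorm,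
      ← ofReal_norm, ENNReal.ofReal_lt_ofReal_iff hcr, smul_sub, smul_smul, hTinv] at h1
    exact h1
  have hexp : Real.exp (-(r + 1)) < Real.exp (-r) := Real.exp_lt_exp.2 (by linarith)
  have hne : Set.Nonempty {zv : ℝ | ∃ u : EuclideanSpace ℝ (Fin p),
          θ₀ + (Real.sqrt (T n))⁻¹ • u ∈ Θ ∧ r < ‖u‖ ∧
          zv = Real.exp ((-(T n)⁻¹ * ‖G n ω (θ₀ + (Real.sqrt (T n))⁻¹ • u)‖ ^ 2) -
                (-(T n)⁻¹ * ‖G n ω θ₀‖ ^ 2))} := by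
    by_contra hemp
    rw [Set.not_nonempty_iff_eq_empty] at hemp
    rw [hemp, Real.sSup_empty] at hev
    exact (Real.exp_pos _).not_ge hev
  obtain ⟨zv, ⟨u, huΘ, hu, rfl⟩, hzv⟩ := exists_lt_of_lt_csSup hne (hexp.trans_le hev)
  rw [Real.exp_lt_exp] at hzv
  have h0 : ‖(√(T n))⁻¹ • G n ω θ₀‖ < √χ / 4 * r := by simpa [hGlim0] using hdev θ₀ hθ₀
  have hz : χ * r ^ 2 ≤ ‖√(T n) • Glim (θ₀ + (√(T n))⁻¹ • u)‖ ^ 2 := by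
    have h1 := hident _ huΘ
    rw [add_sub_cancel_left, norm_smul, mul_pow, Real.norm_of_nonneg (by positivity), inv_pow,
      hsT2] at h1
    rw [norm_smul, mul_pow, Real.norm_of_nonneg hsT.le, hsT2]
    calc χ * r ^ 2 ≤ χ * ‖u‖ ^ 2 := by gcongr
      _ = T n * (χ * ((T n)⁻¹ * ‖u‖ ^ 2)) := by field_simp
      _ ≤ _ := by gcongr
  have key := add_one_lt_sq_sub_sq_of_norm_lt hχ hr1 hr4 hz (hdev _ huΘ) h0
  rw [norm_smul, norm_smul, mul_pow, mul_pow, Real.norm_of_nonneg (by positivity), inv_pow,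
    hsT2] at key
  linarith
end

section
/- Suppose the polynomial-type large deviation inequality with exponent M > 0 holds, and suppose there exists a continuous random field Z₀ on ℝ^p such that Z_n converges weakly to Z₀ in C(B̄(R); ℝ) for every R > 0 (B̄(R) the closed ball of radius R), and that u ↦ Z₀(u) is almost surely maximized at a unique point û_∞. Then û_n converges in distribution to û_∞, and moreover E₀[f(û_n)] → E[f(û_∞)] for every continuous function f : ℝ^p → ℝ such that limsup_{|u|→∞} |u|^{−q}|f(u)| < ∞ for some q ∈ (0, M). -/
open MeasureTheory Filter Topology
open scoped ENNReal NNReal BoundedContinuousFunction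

/-- A random element of `C(K, ℝ)` is measurable as soon as its evaluations are. -/
theorem aestronglyMeasurable_continuousMap_of_eval {Ω K : Type*} [MeasurableSpace Ω]
    {μ : Measure Ω} [MetricSpace K] [CompactSpace K] {Y : Ω → C(K, ℝ)}
    (hY : ∀ u, AEMeasurable (fun ω => Y ω u) μ) : AEStronglyMeasurable Y μ := by
  borelize C(K, ℝ)
  obtain ⟨s, hs, hsd⟩ := TopologicalSpace.exists_countable_dense K
  have : Countable s := hs
  let e : C(K, ℝ) → (s → ℝ) := fun y u => y u
  have he : MeasurableEmbedding e := by
    refine Continuous.measurableEmbedding (continuous_pi fun u => continuous_eval_const _) ?_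
    intro y z hyz
    refine DFunLike.coe_injective (Continuous.ext_on hsd y.continuous z.continuous ?_)
    intro u hu
    exact congrFun hyz ⟨u, hu⟩
  have h : AEMeasurable (e ∘ Y) μ := aemeasurable_pi_iff.2 fun u => hY u
  exact (he.aemeasurable_comp_iff.1 h).aestronglyMeasurable

/-- If `∫ F(Yₙ) → ∫ F(Z)` for all bounded continuous `F`, with `Yₙ` eventually measurable, then
`F(Z)` is integrable, although `Z` is not assumed to be measurable. -/
theorem integrable_of_tendsto_integral {S Ω' : Type*} [TopologicalSpace S] {X : ℕ → Type*}
    [∀ n, MeasurableSpace (X n)] (P : ∀ n, Measure (X n)) [∀ n, IsProbabilityMeasure (P n)]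
    [MeasurableSpace Ω'] (P' : Measure Ω') [IsProbabilityMeasure P']
    (Y : ∀ n, X n → S) (hY : ∀ᶠ n in atTop, AEStronglyMeasurable (Y n) (P n)) (Z : Ω' → S)
    (hlim : ∀ F : S →ᵇ ℝ, Tendsto (fun n => ∫ ω, F (Y n ω) ∂P n) atTop (𝓝 (∫ ω, F (Z ω) ∂P')))
    (F : S →ᵇ ℝ) : Integrable (fun ω => F (Z ω)) P' := by
  by_contra hF
  let F₁ : S →ᵇ ℝ := F + BoundedContinuousFunction.const S 1
  have hF1 : ¬ Integrable (fun ω => F₁ (Z ω)) P' := by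
    intro h
    refine hF ((h.sub (integrable_const (1 : ℝ))).congr (.of_forall fun ω => ?_))
    simp [F₁]
  have h0 := hlim F
  have h1 := hlim F₁
  rw [integral_undef hF] at h0
  rw [integral_undef hF1] at h1
  have h2 : Tendsto (fun n => ∫ ω, F₁ (Y n ω) ∂P n) atTop (𝓝 (0 + 1)) := by
    refine (h0.add_const 1).congr' ?_
    filter_upwards [hY] with n hn
    have hi : Integrable (fun ω => F (Y n ω)) (P n) :=
      .of_bound (F.continuous.comp_aestronglyMeasurable hn) ‖F‖
        (.of_forall fun ω => F.norm_coe_le_norm _)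
    simp [F₁, integral_add hi (integrable_const (1 : ℝ))]
  simpa using tendsto_nhds_unique h1 h2

/-- Continuous approximation from above of the indicator function of `{0 ≤ H}`. -/
noncomputable def rampBCF {S : Type*} [TopologicalSpace S] (H : C(S, ℝ)) (k : ℕ) : S →ᵇ ℝ :=
  BoundedContinuousFunction.ofNormedAddCommGroup
    (fun s => max 0 (1 + k * min (H s) 0)) (by fun_prop) 1 (by
      intro s
      have : (k : ℝ) * min (H s) 0 ≤ 0 :=
        mul_nonpos_of_nonneg_of_nonpos k.cast_nonneg (min_le_right _ _)
      rw [Real.norm_of_nonneg (le_max_left _ _)]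
      exact max_le zero_le_one (by linarith))

theorem rampBCF_apply {S : Type*} [TopologicalSpace S] (H : C(S, ℝ)) (k : ℕ) (s : S) :
    rampBCF H k s = max 0 (1 + k * min (H s) 0) := rfl

theorem rampBCF_nonneg {S : Type*} [TopologicalSpace S] (H : C(S, ℝ)) (k : ℕ) (s : S) :
    0 ≤ rampBCF H k s := le_max_left _ _

theorem rampBCF_of_nonneg {S : Type*} [TopologicalSpace S] (H : C(S, ℝ)) (k : ℕ) {s : S}
    (hs : 0 ≤ H s) : rampBCF H k s = 1 := by
  simp [rampBCF_apply, min_eq_right hs]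

theorem tendsto_rampBCF {S : Type*} [TopologicalSpace S] (H : C(S, ℝ)) (s : S) :
    Tendsto (fun k => rampBCF H k s) atTop (𝓝 (Set.indicator {s | 0 ≤ H s} 1 s)) := by
  by_cases hs : 0 ≤ H s
  · simp [rampBCF_of_nonneg H _ hs, Set.indicator, hs]
  · rw [Set.indicator_of_notMem (by simpa using hs)]
    push Not at hs
    refine tendsto_const_nhds.congr' ?_
    filter_upwards [(tendsto_natCast_atTop_atTop (R := ℝ)).eventually_ge_atTop (-(H s))⁻¹]
      with k hk
    rw [rampBCF_apply, min_eq_left hs.le, max_eq_left]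
    have : (-(H s))⁻¹ * (-(H s)) = 1 := inv_mul_cancel₀ (by linarith)
    nlinarith

/-- Portmanteau inequality for the closed set `{0 ≤ H}`, without measurability of the limit. -/
theorem limsup_measure_le_of_tendsto_integral {S Ω' : Type*} [TopologicalSpace S] {X : ℕ → Type*}
    [∀ n, MeasurableSpace (X n)] (P : ∀ n, Measure (X n)) [∀ n, IsProbabilityMeasure (P n)]
    [MeasurableSpace Ω'] (P' : Measure Ω') [IsProbabilityMeasure P']
    (Y : ∀ n, X n → S) (hY : ∀ᶠ n in atTop, AEStronglyMeasurable (Y n) (P n)) (Z : Ω' → S)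
    (hlim : ∀ F : S →ᵇ ℝ, Tendsto (fun n => ∫ ω, F (Y n ω) ∂P n) atTop (𝓝 (∫ ω, F (Z ω) ∂P')))
    (H : C(S, ℝ)) (A : ∀ n, Set (X n))
    (hA : ∀ᶠ n in atTop, ∀ᵐ ω ∂P n, ω ∈ A n → 0 ≤ H (Y n ω))
    (B : Set Ω') (hB : ∀ᵐ ω ∂P', 0 ≤ H (Z ω) → ω ∈ B) :
    limsup (fun n => P n (A n)) atTop ≤ P' B := by
  have hint := integrable_of_tendsto_integral P P' Y hY Z hlim
  have hle : ∀ k, limsup (fun n => P n (A n)) atTop ≤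
      ENNReal.ofReal (∫ ω, rampBCF H k (Z ω) ∂P') := by
    intro k
    rw [← ((ENNReal.continuous_ofReal.tendsto _).comp (hlim (rampBCF H k))).limsup_eq]
    refine limsup_le_limsup ?_
    filter_upwards [hY, hA] with n hYn hAn
    have hm : AEStronglyMeasurable (fun ω => rampBCF H k (Y n ω)) (P n) :=
      (rampBCF H k).continuous.comp_aestronglyMeasurable hYn
    have hi : Integrable (fun ω => rampBCF H k (Y n ω)) (P n) :=
      .of_bound hm ‖rampBCF H k‖ (.of_forall fun ω => (rampBCF H k).norm_coe_le_norm _)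
    rw [Function.comp_apply,
      ofReal_integral_eq_lintegral_ofReal hi (.of_forall fun ω => rampBCF_nonneg H k _)]
    refine (measure_mono_ae (t := {ω | 0 ≤ H (Y n ω)}) hAn).trans ?_
    refine meas_le_lintegral₀ hm.aemeasurable.ennreal_ofReal fun ω hω => ?_
    rw [rampBCF_of_nonneg H k hω, ENNReal.ofReal_one]
  have htend : Tendsto (fun k => ∫⁻ ω, ENNReal.ofReal (rampBCF H k (Z ω)) ∂P') atTop
      (𝓝 (∫⁻ ω, Set.indicator {ω | 0 ≤ H (Z ω)} 1 ω ∂P')) := by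
    refine tendsto_lintegral_of_dominated_convergence' (fun _ => 1)
      (fun k => (hint _).aestronglyMeasurable.aemeasurable.ennreal_ofReal) (fun k => ?_)
      (by simp) (.of_forall fun ω => ?_)
    · refine .of_forall fun ω => ENNReal.ofReal_le_one.2 ?_
      refine max_le zero_le_one ?_
      have : (k : ℝ) * min (H (Z ω)) 0 ≤ 0 :=
        mul_nonpos_of_nonneg_of_nonpos k.cast_nonneg (min_le_right _ _)
      linarith
    · have h : Set.indicator {ω | 0 ≤ H (Z ω)} (1 : Ω' → ℝ≥0∞) ω =
          ENNReal.ofReal (Set.indicator {s | 0 ≤ H s} 1 (Z ω)) := by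
        by_cases h : 0 ≤ H (Z ω)
        · rw [Set.indicator_of_mem (by exact h), Set.indicator_of_mem (by exact h)]
          simp
        · rw [Set.indicator_of_notMem (by exact h), Set.indicator_of_notMem (by exact h)]
          simp
      rw [h]
      exact (ENNReal.continuous_ofReal.tendsto _).comp (tendsto_rampBCF H (Z ω))
  refine (ge_of_tendsto' htend fun k => ?_).trans
    ((lintegral_indicator_one_le _).trans (measure_mono_ae hB))
  rw [← ofReal_integral_eq_lintegral_ofReal (hint _) (.of_forall fun ω => rampBCF_nonneg H k _)]
  exact hle k

/-- Polynomial tails of order `M` bound moments of order `q < M`, uniformly. -/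
theorem exists_lintegral_rpow_le_of_tail {Ω : Type*} [MeasurableSpace Ω] {C M q : ℝ}
    (hq : 0 < q) (hqM : q < M) :
    ∃ K : ℝ≥0, ∀ (μ : Measure Ω) [IsProbabilityMeasure μ] (W : Ω → ℝ),
      Measurable W → (∀ ω, 0 ≤ W ω) → (∀ r : ℝ, 0 < r → r ^ M * μ.real {ω | r < W ω} ≤ C) →
      ∫⁻ ω, ENNReal.ofReal (W ω ^ q) ∂μ ≤ K := by
  have h1 : ∫⁻ t in Set.Ioc (0 : ℝ) 1, ENNReal.ofReal (t ^ (q - 1)) < ∞ := by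
    have := (intervalIntegrable_iff_integrableOn_Ioc_of_le zero_le_one).1
      (intervalIntegral.intervalIntegrable_rpow' (a := 0) (b := 1) (r := q - 1) (by linarith))
    exact this.lintegral_lt_top
  have h2 : ∫⁻ t in Set.Ioi (1 : ℝ), ENNReal.ofReal (C * t ^ (q - 1 - M)) < ∞ :=
    ((integrableOn_Ioi_rpow_of_lt (by linarith) zero_lt_one).const_mul C).lintegral_lt_top
  have hK := ENNReal.mul_lt_top (ENNReal.ofReal_lt_top (r := q)) (ENNReal.add_lt_top.2 ⟨h1, h2⟩)
  obtain ⟨K, hKeq, -⟩ := ENNReal.lt_iff_exists_coe.1 hK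
  refine ⟨K, fun μ _ W hW hW0 htail => ?_⟩
  rw [lintegral_rpow_eq_lintegral_meas_lt_mul μ (.of_forall hW0) hW.aemeasurable hq]
  refine le_trans ?_ hKeq.le
  gcongr
  rw [← Set.Ioc_union_Ioi_eq_Ioi zero_le_one]
  refine (lintegral_union_le _ _ _).trans (add_le_add ?_ ?_)
  · exact lintegral_mono fun t => (mul_le_mul_left prob_le_one _).trans (one_mul _).le
  · refine setLIntegral_mono' measurableSet_Ioi fun t ht => ?_
    have ht0 : (0 : ℝ) < t := zero_lt_one.trans ht
    rw [← ofReal_measureReal, ← ENNReal.ofReal_mul measureReal_nonneg]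
    refine ENNReal.ofReal_le_ofReal ?_
    have := htail t ht0
    rw [Real.rpow_sub ht0 (q - 1) M, ← mul_div_assoc, le_div_iff₀ (Real.rpow_pos_of_pos ht0 _)]
    have h3 := mul_le_mul_of_nonneg_right this (Real.rpow_nonneg ht0.le (q - 1))
    linarith

theorem integrable_of_lintegral_rpow_abs_le {S : Type*} [MeasurableSpace S] {μ : Measure S}
    [IsFiniteMeasure μ] {f : S → ℝ} (hf : AEStronglyMeasurable f μ) {s : ℝ} (hs : 1 < s) {K : ℝ≥0}
    (hK : ∫⁻ x, ENNReal.ofReal (|f x| ^ s) ∂μ ≤ K) :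
    Integrable (fun x => |f x| ^ s) μ ∧ Integrable f μ := by
  have h1 : Integrable (fun x => |f x| ^ s) μ := by
    refine (lintegral_ofReal_ne_top_iff_integrable ?_ ?_).1 (hK.trans_lt ENNReal.coe_lt_top).ne
    · exact (((measurable_norm.comp_aemeasurable hf.aemeasurable)).pow_const s).aestronglyMeasurable
    · exact .of_forall fun x => Real.rpow_nonneg (abs_nonneg _) _
  refine ⟨h1, ((integrable_const (1 : ℝ)).add h1).mono' hf (.of_forall fun x => ?_)⟩
  rw [Real.norm_eq_abs, Pi.add_apply]
  rcases le_total |f x| 1 with h | h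
  · linarith [Real.rpow_nonneg (abs_nonneg (f x)) s]
  · linarith [Real.self_le_rpow_of_one_le h hs.le]

theorem abs_sub_clip_le {x L s : ℝ} (hL : 0 < L) (hs : 1 < s) :
    |x - max (-L) (min x L)| ≤ L ^ (1 - s) * |x| ^ s := by
  rcases le_or_gt |x| L with h | h
  · rw [abs_le] at h
    rw [min_eq_left h.2, max_eq_right h.1, sub_self, abs_zero]
    positivity
  · have hx : 0 < |x| := hL.trans h
    have h1 : |x - max (-L) (min x L)| ≤ |x| := by
      rcases le_total 0 x with h0 | h0
      · rw [abs_of_nonneg h0] at h ⊢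
        rw [min_eq_right h.le, max_eq_right (by linarith), abs_of_nonneg (by linarith)]
        linarith
      · rw [abs_of_nonpos h0] at h ⊢
        rw [min_eq_left (by linarith), max_eq_left (by linarith), abs_of_nonpos (by linarith)]
        linarith
    have h2 : |x| ^ (1 - s) ≤ L ^ (1 - s) :=
      Real.rpow_le_rpow_of_nonpos hL h.le (by linarith)
    calc _ ≤ |x| := h1
      _ = |x| ^ (1 - s) * |x| ^ s := by rw [← Real.rpow_add hx]; simp
      _ ≤ _ := by gcongr

/-- Weak convergence and a uniform bound on moments of order `s > 1` give convergence of the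
integrals of an unbounded continuous function. -/
theorem tendsto_integral_of_tendsto_of_lintegral_rpow_le {S : Type*} [TopologicalSpace S]
    [MeasurableSpace S] [BorelSpace S] [HasOuterApproxClosed S]
    {μs : ℕ → ProbabilityMeasure S} {μ : ProbabilityMeasure S} (hμ : Tendsto μs atTop (𝓝 μ))
    {f : S → ℝ} (hf : Continuous f) {s : ℝ} (hs : 1 < s) {K : ℝ≥0}
    (hK : ∀ n, ∫⁻ x, ENNReal.ofReal (|f x| ^ s) ∂(μs n : Measure S) ≤ K) :
    Tendsto (fun n => ∫ x, f x ∂(μs n : Measure S)) atTop (𝓝 (∫ x, f x ∂(μ : Measure S))) := by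
  have hcs : Continuous fun x => |f x| ^ s :=
    hf.abs.rpow_const fun _ => Or.inr (by linarith)
  have hK' : ∫⁻ x, ENNReal.ofReal (|f x| ^ s) ∂(μ : Measure S) ≤ K := by
    refine (lintegral_le_liminf_lintegral_of_forall_isOpen_measure_le_liminf_measure hcs
      (fun x => Real.rpow_nonneg (abs_nonneg _) _)
      (fun G hG => ProbabilityMeasure.le_liminf_measure_open_of_tendsto hμ hG)).trans ?_
    exact liminf_le_of_le (by isBoundedDefault)
      fun b hb => (hb.exists.elim fun n hn => hn.trans (hK n))
  have hclip : ∀ L : ℝ, 0 < L → ∀ ν : ProbabilityMeasure S,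
      ∫⁻ x, ENNReal.ofReal (|f x| ^ s) ∂(ν : Measure S) ≤ K →
      |∫ x, f x ∂(ν : Measure S) - ∫ x, max (-L) (min (f x) L) ∂(ν : Measure S)| ≤
        L ^ (1 - s) * K := by
    intro L hL ν hν
    obtain ⟨hi, hif⟩ := integrable_of_lintegral_rpow_abs_le
      hf.measurable.aestronglyMeasurable hs hν
    have hic : Integrable (fun x => max (-L) (min (f x) L)) (ν : Measure S) :=
      (integrable_const (-L)).sup (hif.inf (integrable_const L))
    rw [← integral_sub hif hic]
    refine (abs_integral_le_integral_abs).trans ?_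
    refine (integral_mono (hif.sub hic).abs (hi.const_mul (L ^ (1 - s)))
      fun x => abs_sub_clip_le hL hs).trans ?_
    rw [integral_const_mul]
    gcongr
    rw [integral_eq_lintegral_of_nonneg_ae
      (.of_forall fun x => Real.rpow_nonneg (abs_nonneg _) _) hi.aestronglyMeasurable]
    exact ENNReal.toReal_le_of_le_ofReal K.2 (hν.trans_eq (by simp))
  rw [Metric.tendsto_atTop]
  intro ε hε
  have hL0 : Tendsto (fun L : ℝ => L ^ (1 - s) * K) atTop (𝓝 0) := by
    have := (tendsto_rpow_neg_atTop (y := s - 1) (by linarith)).mul_const (K : ℝ)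
    simpa using this
  obtain ⟨L, hLε, hL⟩ := ((hL0.eventually_lt_const (by linarith : 0 < ε / 3)).and
    (eventually_gt_atTop 0)).exists
  let g : S →ᵇ ℝ := BoundedContinuousFunction.ofNormedAddCommGroup
    (fun x => max (-L) (min (f x) L)) (by fun_prop) L (fun x => by
      rw [Real.norm_eq_abs, abs_le]
      exact ⟨le_max_left _ _, max_le (by linarith) (min_le_right _ _)⟩)
  have hg := ProbabilityMeasure.tendsto_iff_forall_integral_tendsto.1 hμ g
  obtain ⟨N, hN⟩ := Metric.tendsto_atTop.1 hg (ε / 3) (by linarith)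
  refine ⟨N, fun n hn => ?_⟩
  have e1 := hclip L hL (μs n) (hK n)
  have e2 := hclip L hL μ hK'
  have e3 : |∫ x, max (-L) (min (f x) L) ∂(μs n : Measure S) -
    ∫ x, max (-L) (min (f x) L) ∂(μ : Measure S)| < ε / 3 := hN n hn
  rw [Real.dist_eq]
  rw [abs_le] at e1 e2
  rw [abs_lt] at e3 ⊢
  constructor <;> linarith

/-- The difference between the suprema of a function over `A` and over the whole space. -/
noncomputable def supGap {K : Type*} [TopologicalSpace K] [CompactSpace K] {A : Set K}
    (hA : IsCompact A) : C(C(K, ℝ), ℝ) where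
  toFun y := sSup (y '' A) - sSup (y '' Set.univ)
  continuous_toFun :=
    (hA.continuous_sSup (f := fun (y : C(K, ℝ)) u => y u) continuous_eval).sub
      (isCompact_univ.continuous_sSup (f := fun (y : C(K, ℝ)) u => y u) continuous_eval)

theorem supGap_nonneg_iff {K : Type*} [TopologicalSpace K] [CompactSpace K] {A : Set K}
    (hA : IsCompact A) (hAne : A.Nonempty) (y : C(K, ℝ)) :
    0 ≤ supGap hA y ↔ ∃ v ∈ A, ∀ u, y u ≤ y v := by
  have hbdd : ∀ s : Set K, IsCompact s → BddAbove (y '' s) :=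
    fun s hs => hs.bddAbove_image y.continuous.continuousOn
  change 0 ≤ sSup (y '' A) - sSup (y '' Set.univ) ↔ _
  rw [sub_nonneg]
  constructor
  · intro h
    obtain ⟨v, hvA, hv⟩ := hA.exists_sSup_image_eq hAne y.continuous.continuousOn
    exact ⟨v, hvA, fun u => (le_csSup (hbdd _ isCompact_univ)
      (Set.mem_image_of_mem y (Set.mem_univ u))).trans (h.trans_eq hv)⟩
  · rintro ⟨v, hvA, hv⟩
    refine (csSup_le ⟨_, Set.mem_image_of_mem y (Set.mem_univ v)⟩ ?_).trans
      (le_csSup (hbdd _ hA) (Set.mem_image_of_mem y hvA))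
    rintro _ ⟨u, -, rfl⟩
    exact hv u

/-- If random fields converge weakly on a ball, then so do their maximizers, up to the event that
the limiting maximizer lies outside the ball. -/
theorem limsup_measure_maximizer_mem_le {E Ω' : Type*} [NormedAddCommGroup E] [ProperSpace E]
    {X : ℕ → Type*} [∀ n, MeasurableSpace (X n)] (P : ∀ n, Measure (X n))
    [∀ n, IsProbabilityMeasure (P n)] [MeasurableSpace Ω'] (P' : Measure Ω')
    [IsProbabilityMeasure P'] (R : ℝ)
    (Y : ∀ n, X n → C((Metric.closedBall (0 : E) R : Set E), ℝ))
    (hY : ∀ᶠ n in atTop, AEStronglyMeasurable (Y n) (P n))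
    (Z : Ω' → E → ℝ) (hZ : ∀ ω, Continuous (Z ω))
    (hlim : ∀ F : C((Metric.closedBall (0 : E) R : Set E), ℝ) →ᵇ ℝ,
      Tendsto (fun n => ∫ ω, F (Y n ω) ∂P n) atTop
        (𝓝 (∫ ω, F (ContinuousMap.mk (fun u : (Metric.closedBall (0 : E) R : Set E) => Z ω u)
          ((hZ ω).comp continuous_subtype_val)) ∂P')))
    (v : ∀ n, X n → E)
    (hv : ∀ᶠ n in atTop, ∀ᵐ ω ∂P n, ∀ h : v n ω ∈ Metric.closedBall (0 : E) R,
      ∀ u, Y n ω u ≤ Y n ω ⟨v n ω, h⟩)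
    (w : Ω' → E)
    (hw : ∀ᵐ ω ∂P', (∀ u, Z ω u ≤ Z ω (w ω)) ∧ ∀ x, (∀ u, Z ω u ≤ Z ω x) → x = w ω)
    {F : Set E} (hF : IsClosed F) (hFR : F ⊆ Metric.closedBall 0 R) :
    limsup (fun n => P n {ω | v n ω ∈ F}) atTop ≤ P' {ω | w ω ∈ F ∨ R < ‖w ω‖} := by
  rcases F.eq_empty_or_nonempty with rfl | ⟨x, hx⟩
  · simp
  have : CompactSpace (Metric.closedBall (0 : E) R : Set E) :=
    isCompact_iff_compactSpace.1 (isCompact_closedBall 0 R)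
  let A : Set (Metric.closedBall (0 : E) R : Set E) := Subtype.val ⁻¹' F
  have hAc : IsCompact A := (hF.preimage continuous_subtype_val).isCompact
  have hAne : A.Nonempty := ⟨⟨x, hFR hx⟩, hx⟩
  refine limsup_measure_le_of_tendsto_integral P P' Y hY _ hlim (supGap hAc) _ ?_ _ ?_
  · filter_upwards [hv] with n hn
    filter_upwards [hn] with ω hω hωF
    exact (supGap_nonneg_iff hAc hAne _).2 ⟨⟨v n ω, hFR hωF⟩, hωF, hω _⟩
  · filter_upwards [hw] with ω hω hH
    obtain ⟨y, hyA, hy⟩ := (supGap_nonneg_iff hAc hAne _).1 hH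
    by_contra! hcon
    have hle : Z ω (w ω) ≤ Z ω y := hy ⟨w ω, by simpa using hcon.2⟩
    exact hcon.1 (hω.2 y (fun u => (hω.1 u).trans hle) ▸ hyA)

/-- A maximizer over `closure Θ` which is far from `θ₀` in the rescaled parameter forces the
supremum in the large deviation inequality to be at least `exp (-r)`. -/
theorem exp_neg_le_sSup_of_lt_norm {E : Type*} [NormedAddCommGroup E] [NormedSpace ℝ E] {Θ : Set E}
    {θ₀ θ : E} (hθ₀ : θ₀ ∈ Θ) (hθ : θ ∈ closure Θ) {T : ℝ} (hT : 0 < T) {G Gext : E → E}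
    (hcont : ContinuousOn Gext (closure Θ)) (heq : Set.EqOn Gext G Θ)
    (hmax : ∀ η ∈ closure Θ, -T⁻¹ * ‖Gext η‖ ^ 2 ≤ -T⁻¹ * ‖Gext θ‖ ^ 2)
    {r : ℝ} (hr : 0 < r) (hθr : r < ‖Real.sqrt T • (θ - θ₀)‖) :
    Real.exp (-r) ≤ sSup {zv : ℝ | ∃ u : E, θ₀ + (Real.sqrt T)⁻¹ • u ∈ Θ ∧ r < ‖u‖ ∧
      zv = Real.exp ((-T⁻¹ * ‖G (θ₀ + (Real.sqrt T)⁻¹ • u)‖ ^ 2) - (-T⁻¹ * ‖G θ₀‖ ^ 2))} := by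
  have hT' : Real.sqrt T ≠ 0 := (Real.sqrt_pos.2 hT).ne'
  have : (𝓝[Θ] θ).NeBot := mem_closure_iff_nhdsWithin_neBot.1 hθ
  have hc : Tendsto (fun η => Real.exp ((-T⁻¹ * ‖Gext η‖ ^ 2) - (-T⁻¹ * ‖Gext θ₀‖ ^ 2))) (𝓝[Θ] θ)
      (𝓝 (Real.exp ((-T⁻¹ * ‖Gext θ‖ ^ 2) - (-T⁻¹ * ‖Gext θ₀‖ ^ 2)))) :=
    Real.continuous_exp.continuousAt.tendsto.comp
      (((((hcont θ hθ).mono subset_closure).norm.pow 2).const_mul _).sub_const _)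
  have hlt : Real.exp (-r) < Real.exp ((-T⁻¹ * ‖Gext θ‖ ^ 2) - (-T⁻¹ * ‖Gext θ₀‖ ^ 2)) := by
    have := hmax θ₀ (subset_closure hθ₀)
    exact Real.exp_lt_exp.2 (by linarith)
  have hn : Tendsto (fun η => ‖Real.sqrt T • (η - θ₀)‖) (𝓝[Θ] θ) (𝓝 ‖Real.sqrt T • (θ - θ₀)‖) :=
    (Continuous.tendsto (by fun_prop) _).mono_left nhdsWithin_le_nhds
  obtain ⟨η, ⟨hη1, hη2⟩, hηΘ⟩ := ((hc.eventually_const_lt hlt).and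
    (hn.eventually_const_lt hθr)).and self_mem_nhdsWithin |>.exists
  have hη : θ₀ + (Real.sqrt T)⁻¹ • Real.sqrt T • (η - θ₀) = η := by
    rw [inv_smul_smul₀ hT', add_sub_cancel]
  refine hη1.le.trans (le_csSup ⟨Real.exp (0 - (-T⁻¹ * ‖G θ₀‖ ^ 2)), ?_⟩
    ⟨Real.sqrt T • (η - θ₀), by rwa [hη], hη2, by rw [hη, heq hηΘ, heq hθ₀]⟩)
  rintro _ ⟨u, -, -, rfl⟩
  refine Real.exp_le_exp.2 (sub_le_sub_right ?_ _)
  have : 0 ≤ T⁻¹ * ‖G (θ₀ + (Real.sqrt T)⁻¹ • u)‖ ^ 2 := by positivity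
  linarith

/-- Uniform polynomial tails imply tightness. -/
theorem isTightMeasureSet_of_tail {E ι : Type*} [NormedAddCommGroup E] [ProperSpace E]
    [MeasurableSpace E] {μs : ι → Measure E} [∀ i, IsFiniteMeasure (μs i)]
    {C M : ℝ} (hM : 0 < M)
    (htail : ∀ i, ∀ r : ℝ, 0 < r → r ^ M * (μs i).real {u | r < ‖u‖} ≤ C) :
    IsTightMeasureSet (Set.range μs) := by
  refine isTightMeasureSet_of_tendsto_measure_norm_gt ?_
  have h0 : Tendsto (fun r : ℝ => ENNReal.ofReal (C * r ^ (-M))) atTop (𝓝 0) := by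
    have := (tendsto_rpow_neg_atTop hM).const_mul C
    rw [mul_zero] at this
    simpa using ENNReal.tendsto_ofReal this
  refine tendsto_of_tendsto_of_tendsto_of_le_of_le' tendsto_const_nhds h0
    (.of_forall fun _ => zero_le) ?_
  filter_upwards [eventually_gt_atTop 0] with r hr
  refine iSup₂_le ?_
  rintro _ ⟨i, rfl⟩
  rw [← ofReal_measureReal]
  refine ENNReal.ofReal_le_ofReal ?_
  rw [Real.rpow_neg hr.le, ← div_eq_mul_inv, le_div_iff₀ (Real.rpow_pos_of_pos hr _), mul_comm]
  exact htail i r hr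

theorem one_add_rpow_le {x q : ℝ} (hx : 0 ≤ x) (hq : 0 ≤ q) :
    (1 + x) ^ q ≤ 2 ^ q * (1 + x ^ q) := by
  have hm : 1 + x ≤ 2 * max 1 x := by linarith [le_max_left 1 x, le_max_right 1 x]
  refine (Real.rpow_le_rpow (by linarith) hm hq).trans ?_
  rw [Real.mul_rpow zero_le_two (by positivity)]
  gcongr
  rcases le_total 1 x with h | h
  · rw [max_eq_right h]; linarith
  · rw [max_eq_left h, Real.one_rpow]; linarith [Real.rpow_nonneg hx q]

/-- A uniform bound on the moments of order `q * s < M` of a function of growth order `q`. -/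
theorem exists_lintegral_rpow_abs_le_of_growth {E : Type*} [NormedAddCommGroup E]
    [MeasurableSpace E] [BorelSpace E] {f : E → ℝ} {q s M C Cf : ℝ} (hq : 0 < q) (hs : 0 < s)
    (hqs : q * s < M) (hCf : 0 ≤ Cf) (hfb : ∀ u, |f u| ≤ Cf * (1 + ‖u‖) ^ q) :
    ∃ K : ℝ≥0, ∀ (μ : Measure E) [IsProbabilityMeasure μ],
      (∀ r : ℝ, 0 < r → r ^ M * μ.real {u | r < ‖u‖} ≤ C) →
      ∫⁻ u, ENNReal.ofReal (|f u| ^ s) ∂μ ≤ K := by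
  obtain ⟨K, hK⟩ := exists_lintegral_rpow_le_of_tail (Ω := E) (C := C) (mul_pos hq hs) hqs
  refine ⟨(Cf ^ s * 2 ^ (q * s)).toNNReal * (1 + K), fun μ _ htail => ?_⟩
  have hpt : ∀ u, ENNReal.ofReal (|f u| ^ s) ≤
      ENNReal.ofReal (Cf ^ s * 2 ^ (q * s)) * (1 + ENNReal.ofReal (‖u‖ ^ (q * s))) := by
    intro u
    have h0 : 0 ≤ ‖u‖ ^ (q * s) := Real.rpow_nonneg (norm_nonneg _) _
    rw [← ENNReal.ofReal_one, ← ENNReal.ofReal_add zero_le_one h0,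
      ← ENNReal.ofReal_mul (by positivity)]
    refine ENNReal.ofReal_le_ofReal ?_
    refine (Real.rpow_le_rpow (abs_nonneg _) (hfb u) hs.le).trans ?_
    rw [Real.mul_rpow hCf (by positivity), ← Real.rpow_mul (by positivity), mul_assoc]
    gcongr
    exact one_add_rpow_le (norm_nonneg u) (mul_pos hq hs).le
  refine (lintegral_mono hpt).trans ?_
  rw [lintegral_const_mul' _ _ ENNReal.ofReal_ne_top, lintegral_add_left measurable_const,
    lintegral_const, measure_univ, mul_one, ENNReal.coe_mul, ENNReal.coe_add, ENNReal.coe_one]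
  exact mul_le_mul_right (add_le_add_right
    (hK μ (fun u => ‖u‖) measurable_norm (fun u => norm_nonneg u) htail) _) _


/-- the PLDI together with weak convergence of `Z_n` to a continuous random
field `Z₀` on compacts (in `C(B̄(R))`), `Z₀` having an a.s. unique maximum point `û_∞`,
implies `û_n →ᵈ û_∞` and convergence of moments `E₀[f(û_n)] → E[f(û_∞)]` for continuous
`f` of polynomial growth of order `q < M`. -/
theorem stmt4
    (p : ℕ) (Θ : Set (EuclideanSpace ℝ (Fin p)))
    (hΘo : IsOpen Θ) (hΘb : Bornology.IsBounded Θ) (hΘconv : Convex ℝ Θ) (hΘne : Θ.Nonempty)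
    (θ₀ : EuclideanSpace ℝ (Fin p)) (hθ₀ : θ₀ ∈ Θ)
    (X : ℕ → Type) [∀ n, MeasurableSpace (X n)]
    (P : ∀ n, Measure (X n)) [∀ n, IsProbabilityMeasure (P n)]
    (T : ℕ → ℝ) (hTpos : ∀ n, 0 < T n) (hTtop : Tendsto T atTop atTop)
    (G : ∀ n, X n → EuclideanSpace ℝ (Fin p) → EuclideanSpace ℝ (Fin p))
    (hGmeas : ∀ n, Measurable (Function.uncurry (G n)))
    (M : ℝ) (hM : 0 < M)
    -- θ̂_n : a measurable maximizer over closure Θ of the continuous extension of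
    -- M_n(θ) = −T_n⁻¹ |G_n(θ)|²
    (θhat : ∀ n, X n → EuclideanSpace ℝ (Fin p))
    (hθhatmeas : ∀ n, Measurable (θhat n))
    (hθhatmem : ∀ n ω, θhat n ω ∈ closure Θ)
    (hθhatmax : ∀ n, ∀ᵐ ω ∂ P n,
      ∃ Gext : EuclideanSpace ℝ (Fin p) → EuclideanSpace ℝ (Fin p),
        ContinuousOn Gext (closure Θ) ∧ Set.EqOn Gext (G n ω) Θ ∧
        ∀ θ ∈ closure Θ,
          -(T n)⁻¹ * ‖Gext θ‖ ^ 2 ≤ -(T n)⁻¹ * ‖Gext (θhat n ω)‖ ^ 2)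
    -- the PLDI with exponent M
    (hPLDI : ∃ C : ℝ, ∀ r : ℝ, 0 < r → ∀ n,
      r ^ M * (P n {ω | Real.exp (-r) ≤
        sSup {zv : ℝ | ∃ u : EuclideanSpace ℝ (Fin p),
          θ₀ + (Real.sqrt (T n))⁻¹ • u ∈ Θ ∧ r < ‖u‖ ∧
          zv = Real.exp ((-(T n)⁻¹ * ‖G n ω (θ₀ + (Real.sqrt (T n))⁻¹ • u)‖ ^ 2) -
                (-(T n)⁻¹ * ‖G n ω θ₀‖ ^ 2))}}).toReal ≤ C)
    -- the limit random field Z₀, on a probability space (Ω', P'), with continuous paths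
    (Ω' : Type) [MeasurableSpace Ω'] (P' : Measure Ω') [IsProbabilityMeasure P']
    (Z₀ : Ω' → EuclideanSpace ℝ (Fin p) → ℝ)
    (hZcont : ∀ ω', Continuous (Z₀ ω'))
    -- û_∞ : the a.s. unique maximum point of Z₀
    (uinf : Ω' → EuclideanSpace ℝ (Fin p)) (huinfmeas : Measurable uinf)
    (humax : ∀ᵐ ω' ∂ P',
      (∀ u, Z₀ ω' u ≤ Z₀ ω' (uinf ω')) ∧
      (∀ v, (∀ u, Z₀ ω' u ≤ Z₀ ω' v) → v = uinf ω'))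
    -- weak convergence Z_n ⇒ Z₀ in C(B̄(R); ℝ) for every R > 0
    (hweak : ∀ R : ℝ, 0 < R →
      ∃ Y : ∀ n, X n → C((Metric.closedBall (0 : EuclideanSpace ℝ (Fin p)) R : Set _), ℝ),
        (∀ᶠ n in atTop, ∀ᵐ ω ∂ P n,
          ∀ u : (Metric.closedBall (0 : EuclideanSpace ℝ (Fin p)) R : Set _),
            Y n ω u = Real.exp ((-(T n)⁻¹ * ‖G n ω (θ₀ + (Real.sqrt (T n))⁻¹ •
                (u : EuclideanSpace ℝ (Fin p)))‖ ^ 2) - (-(T n)⁻¹ * ‖G n ω θ₀‖ ^ 2))) ∧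
        (∀ F : C((Metric.closedBall (0 : EuclideanSpace ℝ (Fin p)) R : Set _), ℝ) →ᵇ ℝ,
          Tendsto (fun n => ∫ ω, F (Y n ω) ∂ P n) atTop
            (𝓝 (∫ ω', F (ContinuousMap.mk
              (fun u : (Metric.closedBall (0 : EuclideanSpace ℝ (Fin p)) R : Set _) =>
                Z₀ ω' u)
              ((hZcont ω').comp continuous_subtype_val)) ∂ P')))) :
    -- Conclusions: û_n →ᵈ û_∞, and convergence of moments
    (∀ f : EuclideanSpace ℝ (Fin p) →ᵇ ℝ,
      Tendsto (fun n => ∫ ω, f (Real.sqrt (T n) • (θhat n ω - θ₀)) ∂ P n) atTop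
        (𝓝 (∫ ω', f (uinf ω') ∂ P'))) ∧
    (∀ f : EuclideanSpace ℝ (Fin p) → ℝ, Continuous f →
      (∃ q Cf : ℝ, 0 < q ∧ q < M ∧ 0 ≤ Cf ∧ ∀ u, |f u| ≤ Cf * (1 + ‖u‖) ^ q) →
      Tendsto (fun n => ∫ ω, f (Real.sqrt (T n) • (θhat n ω - θ₀)) ∂ P n) atTop
        (𝓝 (∫ ω', f (uinf ω') ∂ P'))) := by
  let E := EuclideanSpace ℝ (Fin p)
  let v : ∀ n, X n → E := fun n ω => Real.sqrt (T n) • (θhat n ω - θ₀)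
  have hsq : ∀ n, Real.sqrt (T n) ≠ 0 := fun n => (Real.sqrt_pos.2 (hTpos n)).ne'
  have hvθ : ∀ n ω, θ₀ + (Real.sqrt (T n))⁻¹ • v n ω = θhat n ω := fun n ω => by
    rw [inv_smul_smul₀ (hsq n), add_sub_cancel]
  have hvm : ∀ n, Measurable (v n) := fun n =>
    ((hθhatmeas n).sub_const θ₀).const_smul (Real.sqrt (T n))
  have hprob : ∀ n, IsProbabilityMeasure ((P n).map (v n)) :=
    fun n => Measure.isProbabilityMeasure_map (hvm n).aemeasurable
  have hprob' : IsProbabilityMeasure (P'.map uinf) :=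
    Measure.isProbabilityMeasure_map huinfmeas.aemeasurable
  let μs : ℕ → ProbabilityMeasure E := fun n => ⟨(P n).map (v n), hprob n⟩
  let μ : ProbabilityMeasure E := ⟨P'.map uinf, hprob'⟩
  obtain ⟨C, hC⟩ := hPLDI
  have htail : ∀ n, ∀ r : ℝ, 0 < r → r ^ M * (μs n : Measure E).real {u | r < ‖u‖} ≤ C := by
    intro n r hr
    refine le_trans ?_ (hC r hr n)
    refine mul_le_mul_of_nonneg_left ?_ (by positivity)
    have hset : MeasurableSet {u : E | r < ‖u‖} := measurableSet_lt measurable_const measurable_norm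
    change ((P n).map (v n) {u | r < ‖u‖}).toReal ≤ _
    rw [Measure.map_apply (hvm n) hset]
    refine ENNReal.toReal_mono (measure_ne_top _ _) (measure_mono_ae ?_)
    filter_upwards [hθhatmax n] with ω ⟨Gext, hcont, heq, hmax⟩ hω
    exact exp_neg_le_sSup_of_lt_norm hθ₀ (hθhatmem n ω) (hTpos n) hcont heq hmax hr hω
  have htight : IsTightMeasureSet (Set.range (ProbabilityMeasure.toMeasure ∘ μs)) :=
    isTightMeasureSet_of_tail (μs := fun n => (μs n : Measure E)) hM htail
  have hball : ∀ R : ℝ, ∀ᶠ n in atTop, ∀ u ∈ Metric.closedBall (0 : E) R,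
      θ₀ + (Real.sqrt (T n))⁻¹ • u ∈ Θ := by
    intro R
    obtain ⟨ε, hε, hεΘ⟩ := Metric.isOpen_iff.1 hΘo θ₀ hθ₀
    have hlim : Tendsto (fun n => (Real.sqrt (T n))⁻¹ * R) atTop (𝓝 0) := by
      have := ((tendsto_inv_atTop_zero.comp (Real.tendsto_sqrt_atTop.comp hTtop)).mul_const R)
      simpa using this
    filter_upwards [hlim.eventually_lt_const hε] with n hn u hu
    refine hεΘ ?_
    rw [mem_ball_iff_norm, add_sub_cancel_left, norm_smul, norm_inv,
      Real.norm_of_nonneg (Real.sqrt_nonneg _)]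
    refine lt_of_le_of_lt ?_ hn
    gcongr
    simpa using hu
  have hbound : ∀ (F : Set E) (R : ℝ), 0 < R → IsClosed F → F ⊆ Metric.closedBall 0 R →
      limsup (fun n => (μs n : Measure E) F) atTop ≤ P' {ω | uinf ω ∈ F ∨ R < ‖uinf ω‖} := by
    intro F R hR hF hFR
    obtain ⟨Y, hYeq, hYlim⟩ := hweak R hR
    have hcompact : CompactSpace (Metric.closedBall (0 : E) R : Set E) :=
      isCompact_iff_compactSpace.1 (isCompact_closedBall 0 R)
    have hYm : ∀ᶠ n in atTop, AEStronglyMeasurable (Y n) (P n) := by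
      filter_upwards [hYeq] with n hn
      refine aestronglyMeasurable_continuousMap_of_eval fun u => ?_
      have hGm : ∀ θ, Measurable fun ω => G n ω θ := fun θ =>
        (hGmeas n).comp (measurable_id.prodMk measurable_const)
      refine AEMeasurable.congr (Measurable.aemeasurable ?_)
        (hn.mono fun ω hω => (hω u).symm)
      exact Real.measurable_exp.comp
        ((((hGm _).norm.pow_const 2).const_mul _).sub (((hGm _).norm.pow_const 2).const_mul _))
    have := limsup_measure_maximizer_mem_le P P' R Y hYm Z₀ hZcont hYlim v ?_ uinf humax hF hFR
    · convert this using 3 with n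
      exact Measure.map_apply (hvm n) hF.measurableSet
    · filter_upwards [hYeq, hball R] with n hn hΘn
      filter_upwards [hn, hθhatmax n] with ω hω ⟨Gext, hcont, heq, hmax⟩ h u
      rw [hω u, hω ⟨v n ω, h⟩]
      refine Real.exp_le_exp.2 (sub_le_sub_right ?_ _)
      have h1 := hmax _ (subset_closure (hΘn u u.2))
      have h2 := hΘn _ h
      rw [heq (hΘn u u.2), ← hvθ n ω, heq h2] at h1
      exact h1
  have hconv : Tendsto μs atTop (𝓝 μ) := by
    refine tendsto_of_forall_isCompact_of_isTightMeasureSet htight fun F hF => ?_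
    rw [← ENNReal.coe_le_coe, ENNReal.ofNNReal_limsup
      (isBoundedUnder_of_eventually_le (a := 1) (by simp))]
    simp_rw [ProbabilityMeasure.ennreal_coeFn_eq_coeFn_toMeasure]
    obtain ⟨R₀, hR₀⟩ := hF.isBounded.subset_closedBall 0
    have hout : Tendsto (fun R : ℝ => P' {ω | R < ‖uinf ω‖}) atTop (𝓝 0) := by
      have := tendsto_measure_norm_gt_of_isTightMeasureSet
        (isTightMeasureSet_singleton (μ := (μ : Measure E)))
      simp only [Set.mem_singleton_iff, iSup_iSup_eq_left] at this
      refine this.congr fun R => Measure.map_apply huinfmeas ?_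
      exact measurableSet_lt measurable_const measurable_norm
    have hsum : Tendsto (fun R : ℝ => (μ : Measure E) F + P' {ω | R < ‖uinf ω‖}) atTop
        (𝓝 ((μ : Measure E) F)) := by
      simpa using tendsto_const_nhds.add hout
    refine ge_of_tendsto hsum ?_
    filter_upwards [eventually_gt_atTop 0, eventually_ge_atTop R₀] with R hR hRR
    refine (hbound F R hR hF.isClosed
      (hR₀.trans (Metric.closedBall_subset_closedBall hRR))).trans ?_
    change _ ≤ P'.map uinf F + _
    rw [Measure.map_apply huinfmeas hF.measurableSet]
    exact measure_union_le (uinf ⁻¹' F) {ω | R < ‖uinf ω‖}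
  have hmap : ∀ f : E → ℝ, Continuous f →
      Tendsto (fun n => ∫ u, f u ∂(μs n : Measure E)) atTop (𝓝 (∫ u, f u ∂(μ : Measure E))) →
      Tendsto (fun n => ∫ ω, f (v n ω) ∂P n) atTop (𝓝 (∫ ω', f (uinf ω') ∂P')) := by
    intro f hf h
    have h1 : ∀ n, ∫ u, f u ∂(μs n : Measure E) = ∫ ω, f (v n ω) ∂P n := fun n =>
      integral_map (hvm n).aemeasurable hf.measurable.aestronglyMeasurable
    have h2 : ∫ u, f u ∂(μ : Measure E) = ∫ ω', f (uinf ω') ∂P' :=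
      integral_map huinfmeas.aemeasurable hf.measurable.aestronglyMeasurable
    rw [← h2]
    exact h.congr h1
  refine ⟨fun f => hmap f f.continuous
    (ProbabilityMeasure.tendsto_iff_forall_integral_tendsto.1 hconv f), ?_⟩
  rintro f hf ⟨q, Cf, hq, hqM, hCf, hfb⟩
  have hqs : q * ((q + M) / (2 * q)) = (q + M) / 2 := by field_simp
  have hs : 1 < (q + M) / (2 * q) := by
    rw [one_lt_div (by positivity)]
    linarith
  obtain ⟨K, hK⟩ := exists_lintegral_rpow_abs_le_of_growth (M := M) (C := C) hq
    (zero_lt_one.trans hs) (by rw [hqs]; linarith) hCf hfb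
  exact hmap f hf (tendsto_integral_of_tendsto_of_lintegral_rpow_le hconv hf hs
    fun n => hK _ (htail n))
end

section
/- Fix q > 0 and set g(x) := 1 + |x|^q. Suppose there exist a probability measure π₀ on ℝ^d and constants a > 0, C > 0 such that ‖P_t(x,·) − π₀‖_g ≤ C e^{−at} g(x) for every t ≥ 0 and x ∈ ℝ^d, and suppose sup_{t≥0} ∫ g d(ηP_t) < ∞. Then the β-mixing coefficient β_X(t) := sup_{s≥0} ∫ ‖P_t(x,·) − ηP_{s+t}‖ (ηP_s)(dx) decays exponentially: there is a constant C′ such that β_X(t) ≤ C′ e^{−at} for all t ≥ 0 (exponential absolute regularity). -/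
open MeasureTheory Filter
open scoped ENNReal NNReal

/-- Integrating a bounded measurable function against a mixture of probability measures. -/
theorem integral_bind_of_bounded {α β : Type*} [MeasurableSpace α] [MeasurableSpace β]
    {μ : Measure α} [IsProbabilityMeasure μ] (κ : ProbabilityTheory.Kernel α β)
    [ProbabilityTheory.IsMarkovKernel κ] {f : β → ℝ} (hf : Measurable f)
    (hf1 : ∀ y, |f y| ≤ 1) :
    Integrable (fun x => ∫ y, f y ∂ κ x) μ ∧
      ∫ y, f y ∂ (μ.bind κ) = ∫ x, ∫ y, f y ∂ κ x ∂ μ := by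
  have hint : Integrable f (μ.bind κ) :=
    Integrable.of_bound hf.aestronglyMeasurable 1 (Eventually.of_forall hf1)
  rw [Measure.comp_eq_comp_const_apply] at hint ⊢
  simpa using And.intro hint.integral_comp (ProbabilityTheory.Kernel.integral_comp hint)

/-- A bound on the `ℝ≥0∞`-valued integral of `1 + ‖y‖ ^ q` yields integrability and the same
bound on the real integral. -/
theorem integrable_one_add_norm_rpow_of_lintegral_le {E : Type*} [NormedAddCommGroup E]
    [MeasurableSpace E] [BorelSpace E] {μ : Measure E} {q : ℝ} (hq : 0 ≤ q) {B : ℝ≥0∞} (hB : B ≠ ⊤)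
    (h : ∫⁻ y, (1 + (‖y‖₊ : ℝ≥0∞) ^ q) ∂ μ ≤ B) :
    Integrable (fun y => 1 + ‖y‖ ^ q) μ ∧ ∫ y, (1 + ‖y‖ ^ q) ∂ μ ≤ B.toReal := by
  have hmeas : Measurable fun y : E => 1 + ‖y‖ ^ q := by fun_prop
  have hnonneg : ∀ y : E, 0 ≤ 1 + ‖y‖ ^ q := fun y => by positivity
  have hof : ∀ y : E, ENNReal.ofReal (1 + ‖y‖ ^ q) = 1 + (‖y‖₊ : ℝ≥0∞) ^ q := fun y => by
    rw [ENNReal.ofReal_add zero_le_one (by positivity), ENNReal.ofReal_one,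
      ← ENNReal.ofReal_rpow_of_nonneg (norm_nonneg y) hq, ofReal_norm, enorm_eq_nnnorm]
  simp_rw [← hof] at h
  refine ⟨(lintegral_ofReal_ne_top_iff_integrable hmeas.aestronglyMeasurable
    (Eventually.of_forall hnonneg)).1 (ne_top_of_le_ne_top hB h), ?_⟩
  rw [integral_eq_lintegral_of_nonneg_ae (Eventually.of_forall hnonneg)
    hmeas.aestronglyMeasurable]
  exact ENNReal.toReal_mono hB h

/-- exponential ergodicity in the `g`-weighted norm implies exponential
absolute regularity (exponential β-mixing). -/
theorem stmt7
    (d : ℕ) (P : ℝ → EuclideanSpace ℝ (Fin d) → Measure (EuclideanSpace ℝ (Fin d)))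
    (hPprob : ∀ t x, IsProbabilityMeasure (P t x))
    (hPmeas : ∀ t : ℝ, ∀ A : Set (EuclideanSpace ℝ (Fin d)), MeasurableSet A →
      Measurable fun x => P t x A)
    (hP0 : ∀ x, P 0 x = Measure.dirac x)
    (hCK : ∀ s t : ℝ, 0 ≤ s → 0 ≤ t → ∀ x, ∀ A : Set (EuclideanSpace ℝ (Fin d)),
      MeasurableSet A → P (s + t) x A = ∫⁻ y, P t y A ∂ P s x)
    (η : Measure (EuclideanSpace ℝ (Fin d))) [IsProbabilityMeasure η]
    (q : ℝ) (hq : 0 < q)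
    (π₀ : Measure (EuclideanSpace ℝ (Fin d))) [IsProbabilityMeasure π₀]
    (a C : ℝ) (ha : 0 < a) (hC : 0 < C)
    -- ‖P_t(x,·) − π₀‖_g ≤ C e^{−at} g(x) with g(x) = 1 + |x|^q, expressed via test functions
    (hergo : ∀ t : ℝ, 0 ≤ t → ∀ x, ∀ f : EuclideanSpace ℝ (Fin d) → ℝ, Measurable f →
      (∀ y, |f y| ≤ 1 + ‖y‖ ^ q) →
      |(∫ y, f y ∂ P t x) - ∫ y, f y ∂ π₀| ≤ C * Real.exp (-a * t) * (1 + ‖x‖ ^ q))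
    -- sup_{t ≥ 0} ∫ g d(ηP_t) < ∞
    (hmom : ∃ B : ℝ≥0∞, B ≠ ⊤ ∧ ∀ t : ℝ, 0 ≤ t →
      ∫⁻ y, (1 + (‖y‖₊ : ℝ≥0∞) ^ q) ∂ (η.bind (P t)) ≤ B) :
    ∃ C' : ℝ, ∀ t : ℝ, 0 ≤ t → ∀ s : ℝ, 0 ≤ s →
      (∫ x, (⨆ f : {f : EuclideanSpace ℝ (Fin d) → ℝ // Measurable f ∧ ∀ y, |f y| ≤ 1},
          |(∫ y, f.1 y ∂ P t x) - ∫ y, f.1 y ∂ (η.bind (P (s + t)))|) ∂ (η.bind (P s)))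
        ≤ C' * Real.exp (-a * t) := by
  obtain ⟨B, hB, hmom⟩ := hmom
  have hP : ∀ t, Measurable (P t) := fun t => Measure.measurable_of_measurable_coe _ (hPmeas t)
  have hmomR := fun t ht =>
    integrable_one_add_norm_rpow_of_lintegral_le hq.le hB (hmom t ht)
  have hprob : ∀ t, IsProbabilityMeasure (η.bind (P t)) := fun t =>
    isProbabilityMeasure_bind (hP t).aemeasurable (Eventually.of_forall (hPprob t))
  obtain ⟨hηint, hηle⟩ : Integrable (fun y => 1 + ‖y‖ ^ q) η ∧
      ∫ y, (1 + ‖y‖ ^ q) ∂ η ≤ B.toReal := by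
    have h0 : P 0 = Measure.dirac := funext hP0
    simpa [h0, Measure.bind_dirac] using hmomR 0 le_rfl
  have hergo1 : ∀ t : ℝ, 0 ≤ t → ∀ x, ∀ f : EuclideanSpace ℝ (Fin d) → ℝ, Measurable f →
      (∀ y, |f y| ≤ 1) →
      |(∫ y, f y ∂ P t x) - ∫ y, f y ∂ π₀| ≤ C * Real.exp (-a * t) * (1 + ‖x‖ ^ q) :=
    fun t ht x f hf hf1 => hergo t ht x f hf fun y =>
      (hf1 y).trans (le_add_of_nonneg_right (by positivity))
  have hmix : ∀ t : ℝ, 0 ≤ t → ∀ f : EuclideanSpace ℝ (Fin d) → ℝ, Measurable f →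
      (∀ y, |f y| ≤ 1) →
      |(∫ y, f y ∂ π₀) - ∫ y, f y ∂ (η.bind (P t))| ≤ C * Real.exp (-a * t) * B.toReal := by
    intro t ht f hf hf1
    let κ : ProbabilityTheory.Kernel _ _ := ⟨P t, hP t⟩
    have : ProbabilityTheory.IsMarkovKernel κ := ⟨hPprob t⟩
    obtain ⟨hi, he⟩ : Integrable (fun x => ∫ y, f y ∂ P t x) η ∧
        ∫ y, f y ∂ (η.bind (P t)) = ∫ x, ∫ y, f y ∂ P t x ∂ η :=
      integral_bind_of_bounded κ hf hf1
    have hsub : (∫ x, ∫ y, f y ∂ P t x ∂ η) - ∫ y, f y ∂ π₀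
        = ∫ x, ((∫ y, f y ∂ P t x) - ∫ y, f y ∂ π₀) ∂ η := by
      rw [integral_sub hi (integrable_const _)]
      simp
    rw [he, abs_sub_comm, hsub]
    calc |∫ x, ((∫ y, f y ∂ P t x) - ∫ y, f y ∂ π₀) ∂ η|
        ≤ ∫ x, C * Real.exp (-a * t) * (1 + ‖x‖ ^ q) ∂ η :=
          norm_integral_le_of_norm_le
            (f := fun x => (∫ y, f y ∂ P t x) - ∫ y, f y ∂ π₀) (hηint.const_mul _)
            (Eventually.of_forall fun x => hergo1 t ht x f hf hf1)
      _ ≤ C * Real.exp (-a * t) * B.toReal := by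
          rw [integral_const_mul]
          gcongr
  refine ⟨2 * C * B.toReal, fun t ht s hs => ?_⟩
  obtain ⟨hsint, hsle⟩ := hmomR s hs
  have hconst := integrable_const (μ := η.bind (P s)) B.toReal
  calc _ ≤ ∫ x, C * Real.exp (-a * t) * ((1 + ‖x‖ ^ q) + B.toReal) ∂ (η.bind (P s)) := by
        refine integral_mono_of_nonneg
          (Eventually.of_forall fun x => Real.iSup_nonneg fun f => abs_nonneg _)
          ((hsint.add hconst).const_mul _)
          (Eventually.of_forall fun x => Real.iSup_le (fun f => ?_) (by positivity))
        have hexp : Real.exp (-a * (s + t)) ≤ Real.exp (-a * t) :=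
          Real.exp_le_exp.2 (by nlinarith)
        calc _ ≤ _ := abs_sub_le _ (∫ y, f.1 y ∂ π₀) _
          _ ≤ C * Real.exp (-a * t) * (1 + ‖x‖ ^ q)
              + C * Real.exp (-a * (s + t)) * B.toReal :=
            add_le_add (hergo1 t ht x f.1 f.2.1 f.2.2)
              (hmix (s + t) (add_nonneg hs ht) f.1 f.2.1 f.2.2)
          _ ≤ C * Real.exp (-a * t) * (1 + ‖x‖ ^ q) + C * Real.exp (-a * t) * B.toReal := by
            gcongr
          _ = _ := by ring
    _ = C * Real.exp (-a * t) * (∫ x, (1 + ‖x‖ ^ q) ∂ (η.bind (P s)) + B.toReal) := by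
        rw [integral_const_mul, integral_add hsint hconst]
        simp
    _ ≤ C * Real.exp (-a * t) * (B.toReal + B.toReal) := by gcongr
    _ = _ := by ring
end

section
/- Suppose: (i) f : ℝ^d × Θ → ℝ is measurable, θ ↦ f(x,θ) is differentiable for each x, and g(x) := sup_{θ∈Θ} ( |f(x,θ)| ∨ |∂_θ f(x,θ)| ) is of at most polynomial growth; (ii) there exist a probability measure π₀ on ℝ^d and a constant a > 0 such that ‖P_t(x,·) − π₀‖_g ≲ e^{−at} g(x) uniformly in t ≥ 0 and x ∈ ℝ^d; (iii) sup_{t≥0} E₀[|X_t|^q] < ∞ for every q > 0. Then for every K > 0, sup_{n∈ℕ} E₀[ sup_{θ∈Θ} | √T_n ( (1/n) Σ_{j=1}^n f(X_{t_{j-1}}, θ) − ∫ f(x,θ) π₀(dx) ) |^K ] < ∞. -/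
open MeasureTheory Filter Topology
open scoped ENNReal NNReal
lemma abs_add_pow_sub_pow_le (x y : ℝ) (n : ℕ) :
    |(x + y) ^ (n + 1) - x ^ (n + 1)| ≤ (n + 1) * |y| * (|x| + |y|) ^ n := by
  have h := abs_pow_sub_pow_le (x + y) x (n + 1)
  have hmax : max |x + y| |x| ≤ |x| + |y| :=
    max_le (abs_add_le x y) (le_add_of_nonneg_right (abs_nonneg y))
  calc _ ≤ _ := h
    _ = (n + 1) * |y| * max |x + y| |x| ^ n := by
      simp only [add_sub_cancel_left, Nat.add_sub_cancel]; push_cast; ring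
    _ ≤ _ := by gcongr

lemma abs_add_pow_sub_pow_sub_le (x y : ℝ) (n : ℕ) :
    |(x + y) ^ (n + 2) - x ^ (n + 2) - (n + 2) * x ^ (n + 1) * y|
      ≤ (n + 2) ^ 2 * y ^ 2 * (|x| + |y|) ^ n := by
  induction n with
  | zero =>
    have : (x + y) ^ (0 + 2) - x ^ (0 + 2) - ((0 : ℕ) + 2) * x ^ (0 + 1) * y = y ^ 2 := by
      push_cast; ring
    rw [this, abs_of_nonneg (sq_nonneg y)]
    push_cast
    nlinarith [sq_nonneg y]
  | succ n ih =>
    have e : (x + y) ^ (n + 1 + 2) - x ^ (n + 1 + 2) - ((n + 1 : ℕ) + 2) * x ^ (n + 1 + 1) * y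
        = (x + y) * ((x + y) ^ (n + 2) - x ^ (n + 2) - (n + 2) * x ^ (n + 1) * y)
          + (n + 2) * x ^ (n + 1) * y ^ 2 := by push_cast; ring
    have h1 : |x| ^ (n + 1) ≤ (|x| + |y|) ^ (n + 1) := by
      gcongr; exact le_add_of_nonneg_right (abs_nonneg y)
    rw [e]
    calc _ ≤ |x + y| * |(x + y) ^ (n + 2) - x ^ (n + 2) - (n + 2) * x ^ (n + 1) * y|
          + (n + 2) * |x| ^ (n + 1) * y ^ 2 := by
          refine (abs_add_le _ _).trans (le_of_eq ?_)
          rw [abs_mul, abs_mul, abs_mul, abs_pow, abs_of_nonneg (sq_nonneg y),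
            abs_of_nonneg (by positivity : (0 : ℝ) ≤ n + 2)]
      _ ≤ (|x| + |y|) * ((n + 2) ^ 2 * y ^ 2 * (|x| + |y|) ^ n)
          + (n + 2) * (|x| + |y|) ^ (n + 1) * y ^ 2 := by
          gcongr
          exact abs_add_le x y
      _ = ((n + 2) ^ 2 + (n + 2)) * (y ^ 2 * (|x| + |y|) ^ (n + 1)) := by ring
      _ ≤ ((n + 1 : ℕ) + 2) ^ 2 * (y ^ 2 * (|x| + |y|) ^ (n + 1)) := by
          gcongr; push_cast; nlinarith
      _ = _ := by ring

lemma sq_mul_abs_add_pow_le {x y G : ℝ} (hy : |y| ≤ G) (k : ℕ) :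
    G ^ 2 * (|x| + |y|) ^ (2 * k) ≤ 4 ^ k * (x ^ (2 * k) * G ^ 2 + G ^ (2 * k + 2)) := by
  have hG : 0 ≤ G := (abs_nonneg y).trans hy
  have h1 : (|x| + |y|) ^ (2 * k) ≤ (|x| + G) ^ (2 * k) := by gcongr
  have h2 := add_pow_le (abs_nonneg x) hG (2 * k)
  have h3 : (2 : ℝ) ^ (2 * k - 1) ≤ 4 ^ k := by
    rw [show (4 : ℝ) = 2 ^ 2 by norm_num, ← pow_mul]
    exact pow_le_pow_right₀ (by norm_num) (Nat.sub_le _ _)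
  have h4 : |x| ^ (2 * k) = x ^ (2 * k) := (even_two_mul k).pow_abs x
  rw [h4] at h2
  have h5 : 0 ≤ x ^ (2 * k) := (even_two_mul k).pow_nonneg x
  calc _ ≤ G ^ 2 * (4 ^ k * (x ^ (2 * k) + G ^ (2 * k))) := by
        gcongr
        refine (h1.trans h2).trans ?_
        gcongr
    _ = _ := by ring

lemma add_pow_le_of_abs_le {x y G : ℝ} (hy : |y| ≤ G) (k : ℕ) :
    (x + y) ^ (2 * k + 2) ≤ x ^ (2 * k + 2) + (2 * k + 2) * (x ^ (2 * k + 1) * y)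
      + (2 * k + 2) ^ 2 * 4 ^ k * (x ^ (2 * k) * G ^ 2 + G ^ (2 * k + 2)) := by
  have h1 := (abs_le.1 (abs_add_pow_sub_pow_sub_le x y (2 * k))).2
  have h2 := sq_mul_abs_add_pow_le (x := x) hy k
  have h3 : y ^ 2 ≤ G ^ 2 := by rw [← sq_abs]; gcongr
  have h4 : ((2 * k : ℕ) + 2 : ℝ) ^ 2 * y ^ 2 * (|x| + |y|) ^ (2 * k) ≤
      (2 * k + 2) ^ 2 * (4 ^ k * (x ^ (2 * k) * G ^ 2 + G ^ (2 * k + 2))) := by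
    push_cast
    rw [mul_assoc]
    refine mul_le_mul_of_nonneg_left (le_trans ?_ h2) (by positivity)
    gcongr
  push_cast at h1 h4
  linarith

lemma abs_add_pow_sub_pow_mul_le {x y G : ℝ} (hy : |y| ≤ G) (k : ℕ) :
    |(x + y) ^ (2 * k + 1) - x ^ (2 * k + 1)| * G
      ≤ (2 * k + 2) ^ 2 * 4 ^ k * (x ^ (2 * k) * G ^ 2 + G ^ (2 * k + 2)) := by
  have hG : 0 ≤ G := (abs_nonneg y).trans hy
  have h1 := abs_add_pow_sub_pow_le x y (2 * k)
  have h2 := sq_mul_abs_add_pow_le (x := x) hy k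
  have h5 : 0 ≤ x ^ (2 * k) := (even_two_mul k).pow_nonneg x
  calc _ ≤ ((2 * k : ℕ) + 1) * G * (|x| + |y|) ^ (2 * k) * G := by
        gcongr; refine h1.trans ?_; gcongr
    _ = (2 * k + 1) * (G ^ 2 * (|x| + |y|) ^ (2 * k)) := by push_cast; ring
    _ ≤ (2 * k + 2) ^ 2 * (4 ^ k * (x ^ (2 * k) * G ^ 2 + G ^ (2 * k + 2))) := by
        gcongr
        nlinarith [(Nat.cast_nonneg k : (0 : ℝ) ≤ k)]
    _ = _ := by ring

lemma pow_mul_sq_le_mul_add {r : ℝ} (hr : 0 < r) (x G : ℝ) (k : ℕ) :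
    x ^ (2 * k) * G ^ 2 ≤ r * x ^ (2 * k + 2) + r⁻¹ ^ k * G ^ (2 * k + 2) := by
  have e1 : x ^ (2 * k) = (x ^ 2) ^ k := pow_mul x 2 k
  have e2 : G ^ (2 * k + 2) = (G ^ 2) ^ k * G ^ 2 := by ring
  have e3 : x ^ (2 * k + 2) = (x ^ 2) ^ k * x ^ 2 := by ring
  rw [e1, e2, e3]
  rcases le_total (G ^ 2) (r * x ^ 2) with h | h
  · have : (x ^ 2) ^ k * G ^ 2 ≤ (x ^ 2) ^ k * (r * x ^ 2) := by gcongr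
    have h' : 0 ≤ r⁻¹ ^ k * ((G ^ 2) ^ k * G ^ 2) := by positivity
    linarith
  · have h1 : x ^ 2 ≤ r⁻¹ * G ^ 2 := by
      rw [← div_eq_inv_mul, le_div_iff₀ hr]; linarith
    have : (x ^ 2) ^ k * G ^ 2 ≤ (r⁻¹ * G ^ 2) ^ k * G ^ 2 := by gcongr
    rw [mul_pow] at this
    have h' : 0 ≤ r * ((x ^ 2) ^ k * x ^ 2) := by positivity
    linarith

lemma sum_range_exp_neg_mul_sub_le {b : ℝ} (hb : 0 < b) (j : ℕ) :
    ∑ i ∈ Finset.range j, Real.exp (-b * ((j : ℝ) - i)) ≤ 1 / b := by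
  induction j with
  | zero => simp; positivity
  | succ j ih =>
    rw [Finset.sum_range_succ]
    have e : ∀ i ∈ Finset.range j, Real.exp (-b * (((j + 1 : ℕ) : ℝ) - i))
        = Real.exp (-b) * Real.exp (-b * ((j : ℝ) - i)) := by
      intro i _; rw [← Real.exp_add]; congr 1; push_cast; ring
    rw [Finset.sum_congr rfl e, ← Finset.mul_sum]
    have e2 : Real.exp (-b * (((j + 1 : ℕ) : ℝ) - j)) = Real.exp (-b) := by
      congr 1; push_cast; ring
    rw [e2]
    have h1 : Real.exp (-b) * (1 + b) ≤ 1 := by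
      rw [Real.exp_neg, inv_mul_le_iff₀ (Real.exp_pos b), mul_one]
      linarith [Real.add_one_le_exp b]
    calc _ ≤ Real.exp (-b) * (1 / b) + Real.exp (-b) := by gcongr
      _ = Real.exp (-b) * (1 + b) * (1 / b) := by field_simp
      _ ≤ 1 * (1 / b) := by gcongr
      _ = _ := one_mul _

/-- A random variable all of whose moments are finite. -/
def HasAllMoments {Ω : Type*} [MeasurableSpace Ω] (F : Ω → ℝ) (μ : Measure Ω) : Prop :=
  ∀ q : ℝ≥0, MemLp F q μ

namespace HasAllMoments

variable {Ω : Type*} [MeasurableSpace Ω] {μ : Measure Ω} {F G : Ω → ℝ}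

lemma integrable (hF : HasAllMoments F μ) : Integrable F μ := by
  have := hF 1
  rwa [ENNReal.coe_one, memLp_one_iff_integrable] at this

lemma add (hF : HasAllMoments F μ) (hG : HasAllMoments G μ) :
    HasAllMoments (fun ω => F ω + G ω) μ := fun q => (hF q).add (hG q)

lemma sub (hF : HasAllMoments F μ) (hG : HasAllMoments G μ) :
    HasAllMoments (fun ω => F ω - G ω) μ := fun q => (hF q).sub (hG q)

lemma abs (hF : HasAllMoments F μ) : HasAllMoments (fun ω => |F ω|) μ := fun q => (hF q).norm

lemma mul (hF : HasAllMoments F μ) (hG : HasAllMoments G μ) :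
    HasAllMoments (fun ω => F ω * G ω) μ := by
  intro q
  have : ENNReal.HolderTriple ((2 * q : ℝ≥0) : ℝ≥0∞) ((2 * q : ℝ≥0) : ℝ≥0∞) q := by
    constructor
    push_cast
    rw [ENNReal.mul_inv (by simp) (by simp), ← add_mul, ENNReal.inv_two_add_inv_two, one_mul]
  exact (hG (2 * q)).mul (hF (2 * q))

lemma const [IsFiniteMeasure μ] (c : ℝ) : HasAllMoments (fun _ : Ω => c) μ :=
  fun _ => memLp_const c

lemma pow [IsFiniteMeasure μ] (hF : HasAllMoments F μ) (n : ℕ) :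
    HasAllMoments (fun ω => F ω ^ n) μ := by
  induction n with
  | zero => simpa using const (μ := μ) 1
  | succ n ih => simpa only [pow_succ] using ih.mul hF

lemma sum {ι : Type*} (s : Finset ι) {F : ι → Ω → ℝ} (hF : ∀ i ∈ s, HasAllMoments (F i) μ) :
    HasAllMoments (fun ω => ∑ i ∈ s, F i ω) μ := fun q =>
  memLp_finsetSum s fun i hi => hF i hi q

lemma mono (hG : HasAllMoments G μ) (hF : AEStronglyMeasurable F μ) (h : ∀ ω, |F ω| ≤ G ω) :
    HasAllMoments F μ := fun q =>
  (hG q).mono hF (Eventually.of_forall fun ω => (h ω).trans (le_abs_self _))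

end HasAllMoments

/-- Even moments of partial sums grow at the diffusive rate when the summands decorrelate
exponentially from the past of the partial sums. -/
lemma integral_sum_pow_le {Ω : Type*} [MeasurableSpace Ω] {μ : Measure Ω} [IsProbabilityMeasure μ]
    {Y G : ℕ → Ω → ℝ} {C b c₀ : ℝ} (hC : 0 ≤ C) (hb : 0 < b) (k : ℕ)
    (hY : ∀ i, HasAllMoments (Y i) μ) (hG : ∀ i, HasAllMoments (G i) μ)
    (hYG : ∀ i ω, |Y i ω| ≤ G i ω) (hGc : ∀ i, ∫ ω, G i ω ^ (2 * k + 2) ∂μ ≤ c₀)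
    (hmix : ∀ i j, i < j →
      |∫ ω, ((∑ l ∈ Finset.range (i + 1), Y l ω) ^ (2 * k + 1)
          - (∑ l ∈ Finset.range i, Y l ω) ^ (2 * k + 1)) * Y j ω ∂μ|
        ≤ C * Real.exp (-b * ((j : ℝ) - i)) *
          ∫ ω, |(∑ l ∈ Finset.range (i + 1), Y l ω) ^ (2 * k + 1)
            - (∑ l ∈ Finset.range i, Y l ω) ^ (2 * k + 1)| * G i ω ∂μ) (n : ℕ) (hn : 0 < n) :
    ∫ ω, (∑ l ∈ Finset.range n, Y l ω) ^ (2 * k + 2) ∂μ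
      ≤ 2 * c₀ * (2 * (n * ((2 * k + 2) ^ 2 * 4 ^ k * ((2 * k + 2) * C / b + 1)))) ^ (k + 1) := by
  set S : ℕ → Ω → ℝ := fun i ω => ∑ l ∈ Finset.range i, Y l ω with hSdef
  have hS : ∀ i, HasAllMoments (S i) μ := fun i => HasAllMoments.sum _ fun l _ => hY l
  have hSs : ∀ i ω, S (i + 1) ω = S i ω + Y i ω := fun i ω => Finset.sum_range_succ _ _
  obtain ⟨i₀, hi₀, hmax⟩ := Finset.exists_max_image (Finset.range (n + 1))
    (fun i => ∫ ω, S i ω ^ (2 * k + 2) ∂μ) ⟨0, by simp⟩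
  set y := ∫ ω, S i₀ ω ^ (2 * k + 2) ∂μ with hy
  set c : ℝ := (2 * k + 2) ^ 2 * 4 ^ k with hc
  have hc1 : 1 ≤ c := by
    have h1 : (1 : ℝ) ≤ (2 * k + 2) ^ 2 := by nlinarith [(Nat.cast_nonneg k : (0 : ℝ) ≤ k)]
    have h2 : (1 : ℝ) ≤ 4 ^ k := one_le_pow₀ (by norm_num)
    nlinarith
  set D := (2 * k + 2) * C / b + 1 with hD
  have hD1 : 1 ≤ D := by
    have : 0 ≤ (2 * k + 2) * C / b := by positivity
    linarith
  set R := n * (c * D) with hR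
  have hn1 : (1 : ℝ) ≤ n := by exact_mod_cast hn
  have hR1 : 1 ≤ R := by
    have : 1 ≤ c * D := one_le_mul_of_one_le_of_one_le hc1 hD1
    exact one_le_mul_of_one_le_of_one_le hn1 this
  have hc₀ : 0 ≤ c₀ := by
    refine le_trans (integral_nonneg fun ω => ?_) (hGc 0)
    exact pow_nonneg ((abs_nonneg _).trans (hYG 0 ω)) _
  set r := (2 * R)⁻¹ with hr
  have hr0 : 0 < r := by positivity
  set B := r * y + (r⁻¹ ^ k + 1) * c₀ with hB
  have hbr : ∀ i, HasAllMoments (fun ω => S i ω ^ (2 * k) * G i ω ^ 2 + G i ω ^ (2 * k + 2)) μ :=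
    fun i => (((hS i).pow _).mul ((hG i).pow _)).add ((hG i).pow _)
  have hBi : ∀ i ≤ n, ∫ ω, (S i ω ^ (2 * k) * G i ω ^ 2 + G i ω ^ (2 * k + 2)) ∂μ ≤ B := by
    intro i hi
    have hyi : ∫ ω, S i ω ^ (2 * k + 2) ∂μ ≤ y := hmax i (by simp; omega)
    calc _ ≤ ∫ ω, (r * S i ω ^ (2 * k + 2) + (r⁻¹ ^ k + 1) * G i ω ^ (2 * k + 2)) ∂μ := by
          refine integral_mono (hbr i).integrable
            ((((hS i).pow _).integrable.const_mul _).add (((hG i).pow _).integrable.const_mul _))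
            fun ω => ?_
          have := pow_mul_sq_le_mul_add hr0 (S i ω) (G i ω) k
          simp only
          linarith
      _ = r * ∫ ω, S i ω ^ (2 * k + 2) ∂μ + (r⁻¹ ^ k + 1) * ∫ ω, G i ω ^ (2 * k + 2) ∂μ := by
          rw [integral_add (((hS i).pow _).integrable.const_mul _)
            (((hG i).pow _).integrable.const_mul _), integral_const_mul, integral_const_mul]
      _ ≤ B := by
          have := hGc i
          rw [hB]
          gcongr
  have hB0 : 0 ≤ B := by
    refine le_trans (integral_nonneg fun ω => ?_) (hBi 0 (Nat.zero_le _))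
    have h1 : 0 ≤ S 0 ω ^ (2 * k) := (even_two_mul k).pow_nonneg _
    have h2 : 0 ≤ G 0 ω := (abs_nonneg _).trans (hYG 0 ω)
    positivity
  have hinc : ∀ i, HasAllMoments (fun ω => S (i + 1) ω ^ (2 * k + 1) - S i ω ^ (2 * k + 1)) μ :=
    fun i => ((hS _).pow _).sub ((hS _).pow _)
  have hcross : ∀ j ≤ n, ∫ ω, S j ω ^ (2 * k + 1) * Y j ω ∂μ ≤ C * (c * B) / b := by
    intro j hj
    have hpt : ∀ ω, S j ω ^ (2 * k + 1) * Y j ω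
        = ∑ i ∈ Finset.range j, (S (i + 1) ω ^ (2 * k + 1) - S i ω ^ (2 * k + 1)) * Y j ω := by
      intro ω
      rw [← Finset.sum_mul, Finset.sum_range_sub (fun i => S i ω ^ (2 * k + 1))]
      simp [hSdef]
    simp_rw [hpt]
    rw [integral_finsetSum _ fun i _ => ((hinc i).mul (hY j)).integrable]
    calc _ ≤ ∑ i ∈ Finset.range j, C * Real.exp (-b * ((j : ℝ) - i)) * (c * B) := by
          refine Finset.sum_le_sum fun i hi => ?_
          rw [Finset.mem_range] at hi
          refine (le_abs_self _).trans ((hmix i j hi).trans ?_)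
          gcongr
          calc _ ≤ ∫ ω, c * (S i ω ^ (2 * k) * G i ω ^ 2 + G i ω ^ (2 * k + 2)) ∂μ := by
                refine integral_mono (((hinc i).abs).mul (hG i)).integrable
                  ((hbr i).integrable.const_mul _) fun ω => ?_
                change |S (i + 1) ω ^ (2 * k + 1) - S i ω ^ (2 * k + 1)| * G i ω ≤ _
                rw [hSs]
                exact abs_add_pow_sub_pow_mul_le (hYG i ω) k
            _ ≤ c * B := by
                rw [integral_const_mul]
                have := hBi i (by omega)
                gcongr
      _ = (∑ i ∈ Finset.range j, Real.exp (-b * ((j : ℝ) - i))) * (C * (c * B)) := by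
          rw [Finset.sum_mul]; exact Finset.sum_congr rfl fun i _ => by ring
      _ ≤ 1 / b * (C * (c * B)) := by
          have := sum_range_exp_neg_mul_sub_le hb j
          gcongr
      _ = _ := by ring
  have hstep : ∀ j ≤ n, ∫ ω, S (j + 1) ω ^ (2 * k + 2) ∂μ
      ≤ ∫ ω, S j ω ^ (2 * k + 2) ∂μ + c * D * B := by
    intro j hj
    have i1 := ((hS j).pow (2 * k + 2)).integrable
    have i2 := (((hS j).pow (2 * k + 1)).mul (hY j)).integrable.const_mul (2 * (k : ℝ) + 2)
    have i3 := (hbr j).integrable.const_mul c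
    calc _ ≤ ∫ ω, (S j ω ^ (2 * k + 2) + (2 * k + 2) * (S j ω ^ (2 * k + 1) * Y j ω)
          + c * (S j ω ^ (2 * k) * G j ω ^ 2 + G j ω ^ (2 * k + 2))) ∂μ := by
          refine integral_mono ((hS _).pow _).integrable ((i1.add i2).add i3) fun ω => ?_
          simp only
          rw [hSs]
          exact add_pow_le_of_abs_le (hYG j ω) k
      _ = ∫ ω, S j ω ^ (2 * k + 2) ∂μ + (2 * k + 2) * ∫ ω, S j ω ^ (2 * k + 1) * Y j ω ∂μ
          + c * ∫ ω, (S j ω ^ (2 * k) * G j ω ^ 2 + G j ω ^ (2 * k + 2)) ∂μ := by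
          have i12 : Integrable (fun ω => S j ω ^ (2 * k + 2)
              + (2 * k + 2) * (S j ω ^ (2 * k + 1) * Y j ω)) μ := i1.add i2
          rw [integral_add i12 i3, integral_add i1 i2, integral_const_mul, integral_const_mul]
      _ ≤ ∫ ω, S j ω ^ (2 * k + 2) ∂μ + (2 * k + 2) * (C * (c * B) / b) + c * B := by
          have := hcross j hj
          have := hBi j hj
          gcongr
      _ = _ := by rw [hD]; ring
  have hall : ∀ j ≤ n, ∫ ω, S j ω ^ (2 * k + 2) ∂μ ≤ j * (c * D * B) := by
    intro j
    induction j with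
    | zero => intro _; simp [hSdef]
    | succ j ih =>
      intro hj
      have h1 := ih (by omega)
      have h2 := hstep j (by omega)
      push_cast
      linarith
  have hi₀n : i₀ ≤ n := by simpa [Nat.lt_succ_iff] using hi₀
  have hyR : y ≤ R * B := by
    refine (hall i₀ hi₀n).trans ?_
    have : (i₀ : ℝ) ≤ n := by exact_mod_cast hi₀n
    calc _ ≤ n * (c * D * B) := by gcongr
      _ = _ := by rw [hR]; ring
  have hRr : R * r = 1 / 2 := by rw [hr]; field_simp
  have hri : r⁻¹ = 2 * R := by rw [hr, inv_inv]
  have hy2 : y ≤ 2 * R * (((2 * R) ^ k + 1) * c₀) := by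
    have : R * B = 1 / 2 * y + R * (((2 * R) ^ k + 1) * c₀) := by
      rw [hB, hri, mul_add, ← mul_assoc, hRr]
    linarith
  have h2R : 1 ≤ (2 * R) ^ k := one_le_pow₀ (by linarith)
  calc _ ≤ y := hmax n (by simp)
    _ ≤ 2 * R * (((2 * R) ^ k + (2 * R) ^ k) * c₀) := by
        refine hy2.trans ?_
        gcongr
    _ = _ := by ring

/-- Truncation of a real number at level `N`. -/
def truncAt (N : ℕ) (x : ℝ) : ℝ := max (-(N : ℝ)) (min x N)

lemma abs_truncAt_le_abs (N : ℕ) (x : ℝ) : |truncAt N x| ≤ |x| := by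
  have hN : (0 : ℝ) ≤ N := N.cast_nonneg
  unfold truncAt
  rw [abs_le]
  refine ⟨?_, max_le (by linarith [abs_nonneg x]) ((min_le_left _ _).trans (le_abs_self x))⟩
  refine le_max_of_le_right (le_min (neg_abs_le x) (by linarith [abs_nonneg x]))

lemma abs_truncAt_le (N : ℕ) (x : ℝ) : |truncAt N x| ≤ N := by
  have hN : (0 : ℝ) ≤ N := N.cast_nonneg
  exact abs_le.2 ⟨le_max_left _ _, max_le (by linarith) (min_le_right _ _)⟩

lemma tendsto_truncAt (x : ℝ) : Tendsto (fun N => truncAt N x) atTop (𝓝 x) := by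
  obtain ⟨M, hM⟩ := exists_nat_ge |x|
  refine tendsto_const_nhds.congr' ?_
  filter_upwards [eventually_ge_atTop M] with N hN
  have : |x| ≤ N := hM.trans (by exact_mod_cast hN)
  rw [abs_le] at this
  rw [truncAt, min_eq_left this.2, max_eq_right this.1]

lemma measurable_truncAt (N : ℕ) : Measurable (truncAt N) :=
  measurable_const.max (measurable_id.min measurable_const)

section Mixing

variable {Ω : Type*} {m m0 : MeasurableSpace Ω} {μ : Measure Ω} [IsProbabilityMeasure μ]

lemma abs_integral_mul_sub_le_of_condExp (hm : m ≤ m0) {W Y D : Ω → ℝ} {c M : ℝ}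
    (hW : StronglyMeasurable[m] W) (hWi : Integrable W μ) (hY : AEStronglyMeasurable Y μ)
    (hYb : ∀ ω, |Y ω| ≤ M) (hD : Integrable (fun ω => |W ω| * D ω) μ)
    (h : ∀ᵐ ω ∂μ, |(μ[Y|m]) ω - c| ≤ D ω) :
    |∫ ω, W ω * (Y ω - c) ∂μ| ≤ ∫ ω, |W ω| * D ω ∂μ := by
  have hYi : Integrable Y μ := (integrable_const M).mono' hY (Eventually.of_forall hYb)
  have hWY : Integrable (W * Y) μ := hWi.mul_bdd (c := M) hY (Eventually.of_forall hYb)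
  have hpull := condExp_mul_of_stronglyMeasurable_left hW hWY hYi
  have hWE : Integrable (fun ω => W ω * (μ[Y|m]) ω) μ := integrable_condExp.congr hpull
  have e : ∫ ω, W ω * (Y ω - c) ∂μ = ∫ ω, W ω * ((μ[Y|m]) ω - c) ∂μ := by
    simp_rw [mul_sub]
    rw [integral_sub (f := fun ω => W ω * Y ω) hWY (hWi.mul_const c),
      integral_sub hWE (hWi.mul_const c)]
    congr 1
    rw [← integral_condExp hm]
    exact integral_congr_ae hpull
  rw [e]
  refine (abs_integral_le_integral_abs).trans (integral_mono_of_nonneg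
    (Eventually.of_forall fun _ => abs_nonneg _) hD ?_)
  filter_upwards [h] with ω hω
  simp only [abs_mul]
  gcongr

lemma abs_integral_mul_sub_le_of_condExp_truncAt (hm : m ≤ m0) {W Y D : Ω → ℝ} {c : ℝ}
    {cs : ℕ → ℝ} (hW : StronglyMeasurable[m] W) (hWi : Integrable W μ)
    (hY : AEStronglyMeasurable Y μ) (hWY : Integrable (fun ω => W ω * Y ω) μ)
    (hD : Integrable (fun ω => |W ω| * D ω) μ) (hcs : Tendsto cs atTop (𝓝 c))
    (h : ∀ N, ∀ᵐ ω ∂μ, |(μ[fun ω => truncAt N (Y ω)|m]) ω - cs N| ≤ D ω) :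
    |∫ ω, W ω * (Y ω - c) ∂μ| ≤ ∫ ω, |W ω| * D ω ∂μ := by
  have hYN : ∀ N, AEStronglyMeasurable (fun ω => truncAt N (Y ω)) μ := fun N =>
    ((measurable_truncAt N).comp_aemeasurable hY.aemeasurable).aestronglyMeasurable
  have hb := fun N => abs_integral_mul_sub_le_of_condExp (μ := μ) hm hW hWi (hYN N)
    (fun ω => abs_truncAt_le N (Y ω)) hD (h N)
  refine le_of_tendsto (x := atTop) (Tendsto.abs ?_) (Eventually.of_forall hb)
  have hiN : ∀ N, Integrable (fun ω => W ω * truncAt N (Y ω)) μ := fun N =>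
    hWi.mul_bdd (c := (N : ℝ)) (hYN N) (Eventually.of_forall fun ω => abs_truncAt_le N (Y ω))
  simp_rw [mul_sub]
  rw [integral_sub hWY (hWi.mul_const c)]
  have e : ∀ N, ∫ ω, (W ω * truncAt N (Y ω) - W ω * cs N) ∂μ
      = ∫ ω, W ω * truncAt N (Y ω) ∂μ - (∫ ω, W ω ∂μ) * cs N := by
    intro N
    rw [integral_sub (hiN N) (hWi.mul_const _), integral_mul_const]
  simp_rw [e]
  rw [integral_mul_const]
  refine Tendsto.sub ?_ (hcs.const_mul _)
  refine tendsto_integral_of_dominated_convergence (fun ω => |W ω * Y ω|)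
    (fun N => (hiN N).aestronglyMeasurable) hWY.abs (fun N => Eventually.of_forall fun ω => ?_)
    (Eventually.of_forall fun ω => (tendsto_truncAt _).const_mul _)
  rw [Real.norm_eq_abs, abs_mul, abs_mul]
  have := abs_truncAt_le_abs N (Y ω)
  gcongr

lemma le_integral_add_of_condExp (hm : m ≤ m0) {Y D : Ω → ℝ} {c : ℝ} (hD : Integrable D μ)
    (h : ∀ᵐ ω ∂μ, |(μ[Y|m]) ω - c| ≤ D ω) : c ≤ ∫ ω, Y ω ∂μ + ∫ ω, D ω ∂μ := by
  rw [← integral_condExp hm, ← integral_add integrable_condExp hD]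
  calc c = ∫ _ω, c ∂μ := by simp
    _ ≤ _ := by
        refine integral_mono_ae (integrable_const _) (integrable_condExp.add hD) ?_
        filter_upwards [h] with ω hω
        have := (abs_le.1 hω).1
        linarith

end Mixing

section Chaining

lemma exists_dyadic_net {p : ℕ} {Θ : Set (EuclideanSpace ℝ (Fin p))}
    (hb : Bornology.IsBounded Θ) (hne : Θ.Nonempty) :
    ∃ (N : ℕ) (A : ℕ → Finset (EuclideanSpace ℝ (Fin p))), ∀ k,
      (∀ u ∈ A k, u ∈ Θ) ∧ (A k).card ≤ N * 2 ^ (k * p) ∧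
        ∀ θ ∈ Θ, ∃ u ∈ A k, ‖θ - u‖ ≤ √p * (2 ^ k)⁻¹ := by
  classical
  obtain ⟨θ₀, hθ₀⟩ := hne
  obtain ⟨r', hr'⟩ := hb.exists_norm_le
  obtain ⟨r, hr⟩ := exists_nat_ge r'
  let cell : ℕ → EuclideanSpace ℝ (Fin p) → Fin p → ℤ := fun k θ i => ⌊2 ^ k * θ i⌋
  let c : ℕ → (Fin p → ℤ) → EuclideanSpace ℝ (Fin p) := fun k z =>
    if h : ∃ θ ∈ Θ, cell k θ = z then h.choose else θ₀
  have hcΘ : ∀ k z, c k z ∈ Θ := by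
    intro k z
    simp only [c]
    split_ifs with h
    exacts [h.choose_spec.1, hθ₀]
  have hcell : ∀ k, ∀ θ ∈ Θ, cell k (c k (cell k θ)) = cell k θ := by
    intro k θ hθ
    have h : ∃ θ' ∈ Θ, cell k θ' = cell k θ := ⟨θ, hθ, rfl⟩
    simp only [c, dif_pos h]
    exact h.choose_spec.2
  refine ⟨(2 * r + 1) ^ p, fun k => (Fintype.piFinset fun _ : Fin p =>
    Finset.Icc (-(r * 2 ^ k : ℤ)) (r * 2 ^ k)).image (c k), fun k => ⟨?_, ?_, ?_⟩⟩
  · intro u hu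
    obtain ⟨z, _, rfl⟩ := Finset.mem_image.1 hu
    exact hcΘ k z
  · refine Finset.card_image_le.trans ?_
    rw [Fintype.card_piFinset]
    simp only [Int.card_Icc, Finset.prod_const, Finset.card_univ, Fintype.card_fin]
    rw [pow_mul, ← mul_pow]
    refine Nat.pow_le_pow_left ?_ p
    have h1 : (1 : ℤ) ≤ 2 ^ k := one_le_pow₀ (by norm_num)
    rw [Int.toNat_le]
    push_cast
    nlinarith
  · intro θ hθ
    refine ⟨c k (cell k θ), Finset.mem_image_of_mem _ ?_, ?_⟩
    · rw [Fintype.mem_piFinset]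
      intro i
      have h1 : |θ i| ≤ r := by
        have := (PiLp.norm_apply_le θ i).trans ((hr' θ hθ).trans hr)
        rwa [Real.norm_eq_abs] at this
      rw [abs_le] at h1
      have h2 : (0 : ℝ) < 2 ^ k := by positivity
      rw [Finset.mem_Icc]
      constructor
      · rw [Int.le_floor]
        push_cast
        nlinarith
      · rw [← Int.cast_le (R := ℝ)]
        refine (Int.floor_le _).trans ?_
        push_cast
        nlinarith
    · set u := c k (cell k θ) with hu
      have h2 : (0 : ℝ) < 2 ^ k := by positivity
      have hi : ∀ i, ‖(θ - u) i‖ ^ 2 ≤ ((2 ^ k)⁻¹ : ℝ) ^ 2 := by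
        intro i
        have h3 : ⌊2 ^ k * u i⌋ = ⌊2 ^ k * θ i⌋ := congrFun (hcell k θ hθ) i
        have h4 := Int.abs_sub_lt_one_of_floor_eq_floor h3.symm
        rw [← mul_sub, abs_mul, abs_of_pos h2] at h4
        have h5 : |θ i - u i| ≤ (2 ^ k)⁻¹ := by
          rw [← one_div, le_div_iff₀ h2]; linarith
        have h6 : ‖(θ - u) i‖ = |θ i - u i| := by simp
        rw [h6]
        gcongr
      rw [EuclideanSpace.norm_eq]
      calc √(∑ i, ‖(θ - u) i‖ ^ 2) ≤ √(∑ _i : Fin p, ((2 ^ k)⁻¹ : ℝ) ^ 2) :=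
            Real.sqrt_le_sqrt (Finset.sum_le_sum fun i _ => hi i)
        _ = √p * (2 ^ k)⁻¹ := by
            rw [Finset.sum_const, Finset.card_univ, Fintype.card_fin, nsmul_eq_mul,
              Real.sqrt_mul (Nat.cast_nonneg p), Real.sqrt_sq (by positivity)]

lemma ennreal_add_pow_le (a b : ℝ≥0∞) (q : ℕ) : (a + b) ^ q ≤ 2 ^ q * (a ^ q + b ^ q) := by
  have h : a + b ≤ 2 * max a b := by
    rw [two_mul]; exact add_le_add (le_max_left _ _) (le_max_right _ _)
  calc (a + b) ^ q ≤ (2 * max a b) ^ q := by gcongr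
    _ = 2 ^ q * (max a b) ^ q := mul_pow _ _ _
    _ ≤ _ := by
      gcongr
      rcases le_total a b with h | h
      · rw [max_eq_right h]; exact le_add_self
      · rw [max_eq_left h]; exact le_self_add

/-- Geometric chaining: the value of a continuous function at the limit of a chain whose increments
decay geometrically is controlled by its value at the start of the chain. -/
lemma enorm_pow_le_of_chain {E : Type*} [NormedAddCommGroup E] {z : E → ℝ} {Θ : Set E}
    (hz : ContinuousOn z Θ) {θ : E} (hθ : θ ∈ Θ) {u : ℕ → E} (hu : ∀ k, u k ∈ Θ)
    (hlim : Tendsto u atTop (𝓝 θ)) {S : ℝ≥0∞} {q : ℕ} (hq : 0 < q)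
    (hS : ∀ k, 2 ^ k * ‖z (u (k + 1)) - z (u k)‖ₑ ^ q ≤ S) :
    ‖z θ‖ₑ ^ q ≤ 2 ^ q * (‖z (u 0)‖ₑ ^ q
      + ((1 - (2⁻¹ : ℝ≥0∞) ^ (1 / (q : ℝ)))⁻¹) ^ q * S) := by
  have hq0 : (0 : ℝ) < q := by exact_mod_cast hq
  set τ := (2⁻¹ : ℝ≥0∞) ^ (1 / (q : ℝ)) with hτ
  set s := S ^ (1 / (q : ℝ)) with hs
  have hτq : τ ^ q = 2⁻¹ := by
    rw [hτ, ← ENNReal.rpow_natCast, ← ENNReal.rpow_mul, one_div_mul_cancel hq0.ne',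
      ENNReal.rpow_one]
  have hsq : s ^ q = S := by
    rw [hs, ← ENNReal.rpow_natCast, ← ENNReal.rpow_mul, one_div_mul_cancel hq0.ne',
      ENNReal.rpow_one]
  have hinc : ∀ k, ‖z (u (k + 1)) - z (u k)‖ₑ ≤ s * τ ^ k := by
    intro k
    rw [← ENNReal.pow_le_pow_left_iff hq.ne', mul_pow, hsq, ← pow_mul, mul_comm k q, pow_mul, hτq,
      ← ENNReal.inv_pow, ← div_eq_mul_inv, ENNReal.le_div_iff_mul_le (by simp) (by simp), mul_comm]
    exact hS k
  have hpart : ∀ k, ‖z (u k)‖ₑ ≤ ‖z (u 0)‖ₑ + s * ∑ i ∈ Finset.range k, τ ^ i := by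
    intro k
    induction k with
    | zero => simp
    | succ k ih =>
      have : z (u (k + 1)) = z (u k) + (z (u (k + 1)) - z (u k)) := by ring
      rw [this, Finset.sum_range_succ, mul_add, ← add_assoc]
      exact (enorm_add_le _ _).trans (add_le_add ih (hinc k))
  have hbound : ∀ k, ‖z (u k)‖ₑ ≤ ‖z (u 0)‖ₑ + s * (1 - τ)⁻¹ := by
    intro k
    refine (hpart k).trans ?_
    gcongr
    rw [← ENNReal.tsum_geometric]
    exact ENNReal.sum_le_tsum _
  have hzlim : Tendsto (fun k => ‖z (u k)‖ₑ) atTop (𝓝 ‖z θ‖ₑ) := by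
    refine (continuous_enorm.tendsto _).comp ((hz θ hθ).tendsto.comp ?_)
    exact tendsto_nhdsWithin_iff.2 ⟨hlim, Eventually.of_forall hu⟩
  have hfin := le_of_tendsto' hzlim hbound
  calc _ ≤ (‖z (u 0)‖ₑ + s * (1 - τ)⁻¹) ^ q := by gcongr
    _ ≤ _ := ennreal_add_pow_le _ _ _
    _ = _ := by rw [mul_pow s, hsq, mul_comm S]

/-- Uniform moment bound for a random field with Lipschitz increments in `L^q` over a bounded
subset of Euclidean space. -/
lemma exists_lintegral_iSup_enorm_pow_le {p : ℕ} {Θ : Set (EuclideanSpace ℝ (Fin p))}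
    (hb : Bornology.IsBounded Θ) (hne : Θ.Nonempty) {q : ℕ} (hq : 2 * p + 2 ≤ q) :
    ∃ B : ℝ≥0∞, B ≠ ⊤ ∧ ∀ {Ω : Type} [MeasurableSpace Ω] (μ : Measure Ω)
      (Z : EuclideanSpace ℝ (Fin p) → Ω → ℝ) (M : ℝ≥0∞),
      (∀ θ ∈ Θ, Measurable (Z θ)) → (∀ ω, ContinuousOn (fun θ => Z θ ω) Θ) →
      (∀ θ ∈ Θ, ∫⁻ ω, ‖Z θ ω‖ₑ ^ q ∂μ ≤ M) →
      (∀ θ ∈ Θ, ∀ θ' ∈ Θ, ∫⁻ ω, ‖Z θ ω - Z θ' ω‖ₑ ^ q ∂μ ≤ M * ‖θ - θ'‖ₑ ^ q) →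
      ∫⁻ ω, ⨆ θ ∈ Θ, ‖Z θ ω‖ₑ ^ q ∂μ ≤ B * M := by
  classical
  obtain ⟨N, A, hA⟩ := exists_dyadic_net hb hne
  have hq0 : 0 < q := by omega
  set ρ : ℝ := 2 * √p with hρ
  have hρ0 : 0 ≤ ρ := by positivity
  let pairs : ℕ → Finset (EuclideanSpace ℝ (Fin p) × EuclideanSpace ℝ (Fin p)) := fun k =>
    (A (k + 1) ×ˢ A k).filter fun e => ‖e.1 - e.2‖ ≤ ρ * (2 ^ k)⁻¹
  set L : ℝ≥0∞ := ((1 - (2⁻¹ : ℝ≥0∞) ^ (1 / (q : ℝ)))⁻¹) ^ q with hL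
  have hLtop : L ≠ ⊤ := by
    refine ENNReal.pow_ne_top (ENNReal.inv_ne_top.2 (tsub_pos_of_lt ?_).ne')
    exact ENNReal.rpow_lt_one (by simp) (by positivity)
  set Q : ℝ≥0∞ := ((N * 2 ^ p) * N : ℕ) * ENNReal.ofReal ρ ^ q with hQ
  refine ⟨2 ^ q * ((A 0).card + L * (2 * Q)), ?_, ?_⟩
  · have hQtop : Q ≠ ⊤ := ENNReal.mul_ne_top (ENNReal.natCast_ne_top _) (by finiteness)
    finiteness
  intro Ω _ μ Z M hZm hZc hZ hZinc
  set D : ℕ → Ω → ℝ≥0∞ := fun k ω => 2 ^ k * ∑ e ∈ pairs k, ‖Z e.1 ω - Z e.2 ω‖ₑ ^ q with hD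
  set S : Ω → ℝ≥0∞ := fun ω => ∑' k, D k ω with hS
  have hpm : ∀ k, ∀ e ∈ pairs k, e.1 ∈ Θ ∧ e.2 ∈ Θ ∧ ‖e.1 - e.2‖ ≤ ρ * (2 ^ k)⁻¹ := by
    intro k e he
    obtain ⟨h1, h2⟩ := Finset.mem_filter.1 he
    obtain ⟨h3, h4⟩ := Finset.mem_product.1 h1
    exact ⟨(hA _).1 _ h3, (hA _).1 _ h4, h2⟩
  have hmeas : ∀ k, ∀ e ∈ pairs k, Measurable fun ω => ‖Z e.1 ω - Z e.2 ω‖ₑ ^ q := fun k e he =>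
    ((hZm _ (hpm k e he).1).sub (hZm _ (hpm k e he).2.1)).enorm.pow_const q
  have hDm : ∀ k, Measurable (D k) := fun k =>
    (Finset.measurable_fun_sum _ fun e he => hmeas k e he).const_mul _
  have hDint : ∀ k, ∫⁻ ω, D k ω ∂μ ≤ Q * M * 2⁻¹ ^ k := by
    intro k
    have hcard : (pairs k).card ≤ (N * 2 ^ p) * N * 2 ^ (k * (2 * p)) := by
      refine (Finset.card_filter_le _ _).trans ?_
      rw [Finset.card_product]
      calc _ ≤ (N * 2 ^ ((k + 1) * p)) * (N * 2 ^ (k * p)) :=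
            Nat.mul_le_mul (hA _).2.1 (hA _).2.1
        _ = _ := by ring
    have hterm : ∀ e ∈ pairs k, ∫⁻ ω, ‖Z e.1 ω - Z e.2 ω‖ₑ ^ q ∂μ
        ≤ M * (ENNReal.ofReal ρ ^ q * 2⁻¹ ^ (k * q)) := by
      intro e he
      obtain ⟨h1, h2, h3⟩ := hpm k e he
      refine (hZinc _ h1 _ h2).trans ?_
      have h4 : ‖e.1 - e.2‖ₑ ≤ ENNReal.ofReal ρ * 2⁻¹ ^ k := by
        rw [← ofReal_norm]
        refine (ENNReal.ofReal_le_ofReal h3).trans (le_of_eq ?_)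
        rw [ENNReal.ofReal_mul hρ0, ENNReal.ofReal_inv_of_pos (by positivity),
          ENNReal.ofReal_pow (by norm_num), ENNReal.inv_pow]
        norm_num
      rw [pow_mul, ← mul_pow]
      gcongr
    rw [lintegral_const_mul _ (Finset.measurable_fun_sum _ fun e he => hmeas k e he),
      lintegral_finsetSum _ fun e he => hmeas k e he]
    have h2 : (2 : ℝ≥0∞) ^ (k * (2 * p + 1)) * 2⁻¹ ^ (k * q) ≤ 2⁻¹ ^ k := by
      have : (2⁻¹ : ℝ≥0∞) ^ (k * q) ≤ 2⁻¹ ^ (k * (2 * p + 2)) :=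
        pow_le_pow_right_of_le_one' (by simp) (Nat.mul_le_mul_left k hq)
      calc _ ≤ (2 : ℝ≥0∞) ^ (k * (2 * p + 1)) * 2⁻¹ ^ (k * (2 * p + 2)) := by gcongr
        _ = (2 * 2⁻¹) ^ (k * (2 * p + 1)) * 2⁻¹ ^ k := by rw [mul_pow]; ring
        _ = _ := by rw [ENNReal.mul_inv_cancel (by simp) (by simp), one_pow, one_mul]
    calc _ ≤ 2 ^ k * ∑ _e ∈ pairs k, M * (ENNReal.ofReal ρ ^ q * 2⁻¹ ^ (k * q)) := by
          gcongr with e he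
          exact hterm e he
      _ = 2 ^ k * ((pairs k).card * (M * (ENNReal.ofReal ρ ^ q * 2⁻¹ ^ (k * q)))) := by
          rw [Finset.sum_const, nsmul_eq_mul]
      _ ≤ 2 ^ k * (((N * 2 ^ p) * N * 2 ^ (k * (2 * p)) : ℕ)
            * (M * (ENNReal.ofReal ρ ^ q * 2⁻¹ ^ (k * q)))) := by
          gcongr
      _ = Q * M * (2 ^ (k * (2 * p + 1)) * 2⁻¹ ^ (k * q)) := by
          rw [hQ]; push_cast; ring
      _ ≤ _ := by gcongr
  have hSint : ∫⁻ ω, S ω ∂μ ≤ 2 * Q * M := by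
    rw [hS, lintegral_tsum fun k => (hDm k).aemeasurable]
    calc _ ≤ ∑' k, Q * M * 2⁻¹ ^ k := ENNReal.tsum_le_tsum hDint
      _ = Q * M * 2 := by rw [ENNReal.tsum_mul_left, ENNReal.tsum_geometric_two]
      _ = _ := by ring
  have hpath : ∀ ω, ⨆ θ ∈ Θ, ‖Z θ ω‖ₑ ^ q ≤
      2 ^ q * (∑ u ∈ A 0, ‖Z u ω‖ₑ ^ q + L * S ω) := by
    intro ω
    refine iSup₂_le fun θ hθ => ?_
    choose u huA hu using fun k => (hA k).2.2 θ hθ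
    have huΘ : ∀ k, u k ∈ Θ := fun k => (hA k).1 _ (huA k)
    have hlim : Tendsto u atTop (𝓝 θ) := by
      rw [tendsto_iff_norm_sub_tendsto_zero]
      have h0 : Tendsto (fun k : ℕ => √p * ((2 : ℝ) ^ k)⁻¹) atTop (𝓝 0) := by
        have := tendsto_pow_atTop_nhds_zero_of_lt_one (r := (2⁻¹ : ℝ)) (by norm_num) (by norm_num)
        simpa [inv_pow] using this.const_mul √p
      refine squeeze_zero (fun k => norm_nonneg _) (fun k => ?_) h0
      rw [norm_sub_rev]; exact hu k
    refine (enorm_pow_le_of_chain (S := S ω) (hZc ω) hθ huΘ hlim hq0 fun k => ?_).trans ?_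
    · have hmem : (u (k + 1), u k) ∈ pairs k := by
        refine Finset.mem_filter.2 ⟨Finset.mem_product.2 ⟨huA _, huA _⟩, ?_⟩
        have e : u (k + 1) - u k = (θ - u k) - (θ - u (k + 1)) := by abel
        have h1 : √p * ((2 : ℝ) ^ (k + 1))⁻¹ ≤ √p * (2 ^ k)⁻¹ := by
          gcongr
          · norm_num
          · omega
        simp only
        rw [e]
        refine (norm_sub_le _ _).trans ?_
        linarith [hu k, hu (k + 1)]
      refine le_trans ?_ (ENNReal.le_tsum (f := fun k => D k ω) k)
      simp only [hD]
      gcongr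
      exact Finset.single_le_sum (f := fun e => ‖Z e.1 ω - Z e.2 ω‖ₑ ^ q)
        (fun _ _ => zero_le) hmem
    · gcongr
      exact Finset.single_le_sum (f := fun u => ‖Z u ω‖ₑ ^ q) (fun _ _ => zero_le) (huA 0)
  have hm0 : ∀ u ∈ A 0, Measurable fun ω => ‖Z u ω‖ₑ ^ q := fun u hu =>
    (hZm _ ((hA 0).1 u hu)).enorm.pow_const q
  have hSm : Measurable S := Measurable.tsum hDm
  calc _ ≤ ∫⁻ ω, 2 ^ q * (∑ u ∈ A 0, ‖Z u ω‖ₑ ^ q + L * S ω) ∂μ := lintegral_mono hpath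
    _ = 2 ^ q * (∑ u ∈ A 0, ∫⁻ ω, ‖Z u ω‖ₑ ^ q ∂μ + L * ∫⁻ ω, S ω ∂μ) := by
        have hm1 : Measurable fun ω => ∑ u ∈ A 0, ‖Z u ω‖ₑ ^ q + L * S ω :=
          (Finset.measurable_fun_sum _ hm0).add (hSm.const_mul L)
        rw [lintegral_const_mul _ hm1,
          lintegral_add_left (Finset.measurable_fun_sum _ hm0), lintegral_finsetSum _ hm0,
          lintegral_const_mul _ hSm]
    _ ≤ 2 ^ q * (∑ _u ∈ A 0, M + L * (2 * Q * M)) := by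
        gcongr with u hu
        exact hZ u ((hA 0).1 u hu)
    _ = _ := by rw [Finset.sum_const, nsmul_eq_mul]; ring

end Chaining

lemma integrable_and_integral_abs_le_of_truncAt {E : Type*} [MeasurableSpace E] {π : Measure E}
    [IsFiniteMeasure π] {φ : E → ℝ} (hφ : Measurable φ) {c : ℝ}
    (h : ∀ N : ℕ, ∫ x, |truncAt N (φ x)| ∂π ≤ c) :
    Integrable φ π ∧ ∫ x, |φ x| ∂π ≤ c := by
  have hc : 0 ≤ c := (integral_nonneg fun _ => abs_nonneg _).trans (h 0)
  have hN : ∀ N : ℕ, ∫⁻ x, ‖truncAt N (φ x)‖ₑ ∂π ≤ ENNReal.ofReal c := by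
    intro N
    have hi : Integrable (fun x => truncAt N (φ x)) π :=
      (integrable_const (N : ℝ)).mono' ((measurable_truncAt N).comp hφ).aestronglyMeasurable
        (Eventually.of_forall fun x => abs_truncAt_le N (φ x))
    rw [← ofReal_integral_norm_eq_lintegral_enorm hi]
    exact ENNReal.ofReal_le_ofReal (h N)
  have hlim : ∫⁻ x, ‖φ x‖ₑ ∂π ≤ ENNReal.ofReal c := by
    have e : ∀ x, ‖φ x‖ₑ = liminf (fun N : ℕ => ‖truncAt N (φ x)‖ₑ) atTop := fun x =>
      (((continuous_enorm.tendsto _).comp (tendsto_truncAt (φ x))).liminf_eq).symm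
    simp_rw [e]
    refine (lintegral_liminf_le fun N => ((measurable_truncAt N).comp hφ).enorm).trans ?_
    refine (liminf_le_liminf (Eventually.of_forall hN)).trans ?_
    simp
  have hφi : Integrable φ π := ⟨hφ.aestronglyMeasurable, hlim.trans_lt ENNReal.ofReal_lt_top⟩
  refine ⟨hφi, ?_⟩
  rw [← ENNReal.ofReal_le_ofReal_iff hc]
  have := ofReal_integral_norm_eq_lintegral_enorm hφi
  simp only [Real.norm_eq_abs] at this
  rwa [this]

lemma hasAllMoments_norm {Ω E : Type*} [MeasurableSpace Ω] [NormedAddCommGroup E]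
    [MeasurableSpace E] [OpensMeasurableSpace E] {μ : Measure Ω} {Y : Ω → E} (hY : Measurable Y)
    (h : ∀ q : ℝ, 0 < q → ∫⁻ ω, (‖Y ω‖₊ : ℝ≥0∞) ^ q ∂μ ≠ ⊤) :
    HasAllMoments (fun ω => ‖Y ω‖) μ := by
  intro q
  refine ⟨hY.norm.aestronglyMeasurable, ?_⟩
  rcases eq_or_ne q 0 with rfl | hq
  · simp
  · rw [eLpNorm_lt_top_iff_lintegral_rpow_enorm_lt_top (by simpa using hq) (by simp)]
    simpa [enorm_eq_nnnorm] using (h q (by positivity)).lt_top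

section Ergodic

variable {Ω : Type*} [MeasurableSpace Ω] {E : Type*} [MeasurableSpace E]

/-- The process `X` forgets its past exponentially fast, at rate `a`, when tested against bounded
measurable functions dominated by `g`; the prefactor is governed by `V` at the present state. -/
def IsExpMixing (μ : Measure Ω) (X : ℝ → Ω → E) (π : Measure E) (g V : E → ℝ) (C a : ℝ) : Prop :=
  ∀ s t : ℝ, 0 ≤ s → 0 ≤ t → ∀ φ : E → ℝ, Measurable φ → (∃ c, ∀ y, |φ y| ≤ c) →
    (∀ y, |φ y| ≤ g y) → ∀ᵐ ω ∂μ,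
      |(μ[fun ω => φ (X (s + t) ω) |
          ⨆ u ∈ Set.Icc (0 : ℝ) s, MeasurableSpace.comap (X u) inferInstance]) ω - ∫ y, φ y ∂π|
        ≤ C * Real.exp (-a * t) * V (X s ω)

variable {μ : Measure Ω} {X : ℝ → Ω → E} {π : Measure E}
  {g V : E → ℝ} {C a : ℝ}

lemma iSup_comap_le {Ω E : Type*} [MeasurableSpace Ω] [MeasurableSpace E] {X : ℝ → Ω → E}
    (hX : ∀ t, Measurable (X t)) (s : ℝ) :
    (⨆ u ∈ Set.Icc (0 : ℝ) s, MeasurableSpace.comap (X u) inferInstance)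
      ≤ (inferInstance : MeasurableSpace Ω) :=
  iSup₂_le fun u _ => (hX u).comap_le

lemma IsExpMixing.integrable_and_integral_abs_le [IsProbabilityMeasure μ] [IsFiniteMeasure π]
    (hmix : IsExpMixing μ X π g V C a)
    (hX : ∀ t, Measurable (X t)) (hgV : ∀ x, g x ≤ V x)
    (hV : Integrable (fun ω => V (X 0 ω)) μ) {φ : E → ℝ} (hφ : Measurable φ)
    (hφg : ∀ y, |φ y| ≤ g y) :
    Integrable φ π ∧ ∫ x, |φ x| ∂π ≤ (1 + C) * ∫ ω, V (X 0 ω) ∂μ := by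
  refine integrable_and_integral_abs_le_of_truncAt hφ fun N => ?_
  set ψ : E → ℝ := fun x => |truncAt N (φ x)| with hψ
  have hψm : Measurable ψ := ((measurable_truncAt N).comp hφ).norm
  have hψN : ∀ x, |ψ x| ≤ N := fun x => by
    rw [hψ]; simp only [abs_abs]; exact abs_truncAt_le N _
  have hψg : ∀ x, |ψ x| ≤ g x := fun x => by
    rw [hψ]; simp only [abs_abs]; exact (abs_truncAt_le_abs N _).trans (hφg x)
  have h := hmix 0 0 le_rfl le_rfl ψ hψm ⟨N, hψN⟩ hψg
  have hψi : Integrable (fun ω => ψ (X 0 ω)) μ :=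
    (integrable_const (N : ℝ)).mono' (hψm.comp (hX 0)).aestronglyMeasurable
      (Eventually.of_forall fun ω => hψN _)
  calc ∫ x, ψ x ∂π ≤ ∫ ω, ψ (X (0 + 0) ω) ∂μ
        + ∫ ω, C * Real.exp (-a * 0) * V (X 0 ω) ∂μ :=
        le_integral_add_of_condExp (iSup_comap_le hX 0) (hV.const_mul _) h
    _ = ∫ ω, ψ (X 0 ω) ∂μ + C * ∫ ω, V (X 0 ω) ∂μ := by
        rw [integral_const_mul]; simp
    _ ≤ ∫ ω, V (X 0 ω) ∂μ + C * ∫ ω, V (X 0 ω) ∂μ := by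
        refine add_le_add_left (integral_mono hψi hV fun ω => ?_) _
        exact (le_abs_self _).trans ((hψg _).trans (hgV _))
    _ = _ := by ring

lemma IsExpMixing.abs_integral_mul_sub_le [IsProbabilityMeasure μ]
    (hmix : IsExpMixing μ X π g V C a)
    (hX : ∀ t, Measurable (X t)) {φ : E → ℝ} (hφ : Measurable φ) (hφg : ∀ y, |φ y| ≤ g y)
    (hφπ : Integrable φ π) {s t : ℝ} (hs : 0 ≤ s) (hst : s ≤ t) {W : Ω → ℝ}
    (hWs : StronglyMeasurable[⨆ u ∈ Set.Icc (0 : ℝ) s,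
      MeasurableSpace.comap (X u) inferInstance] W)
    (hW : HasAllMoments W μ) (hφX : HasAllMoments (fun ω => φ (X t ω)) μ)
    (hV : HasAllMoments (fun ω => V (X s ω)) μ) :
    |∫ ω, W ω * (φ (X t ω) - ∫ y, φ y ∂π) ∂μ|
      ≤ C * Real.exp (-a * (t - s)) * ∫ ω, |W ω| * V (X s ω) ∂μ := by
  have hD : Integrable (fun ω => |W ω| * (C * Real.exp (-a * (t - s)) * V (X s ω))) μ := by
    have := ((hW.abs.mul hV).integrable).const_mul (C * Real.exp (-a * (t - s)))
    refine this.congr (Eventually.of_forall fun ω => ?_)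
    simp only; ring
  have hcs : Tendsto (fun N : ℕ => ∫ y, truncAt N (φ y) ∂π) atTop (𝓝 (∫ y, φ y ∂π)) := by
    refine tendsto_integral_of_dominated_convergence (fun y => |φ y|)
      (fun N => ((measurable_truncAt N).comp hφ).aestronglyMeasurable) hφπ.abs
      (fun N => Eventually.of_forall fun y => abs_truncAt_le_abs N _)
      (Eventually.of_forall fun y => tendsto_truncAt _)
  refine (abs_integral_mul_sub_le_of_condExp_truncAt (iSup_comap_le hX s) hWs hW.integrable
    (hφ.comp (hX t)).aestronglyMeasurable (hW.mul hφX).integrable hD hcs fun N => ?_).trans ?_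
  · have := hmix s (t - s) hs (by linarith) (fun y => truncAt N (φ y))
      ((measurable_truncAt N).comp hφ) ⟨N, fun y => abs_truncAt_le N _⟩
      fun y => (abs_truncAt_le_abs N _).trans (hφg y)
    rwa [add_sub_cancel] at this
  · rw [← integral_const_mul]
    refine le_of_eq (integral_congr_ae (Eventually.of_forall fun ω => ?_))
    simp only; ring

variable [NormedAddCommGroup E] [IsProbabilityMeasure μ]

lemma exists_integral_one_add_norm_pow_le [OpensMeasurableSpace E] (hX : ∀ t, Measurable (X t))
    (hmom : ∀ q : ℝ, 0 < q → ∃ B : ℝ≥0∞, B ≠ ⊤ ∧ ∀ t : ℝ, 0 ≤ t →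
      ∫⁻ ω, (‖X t ω‖₊ : ℝ≥0∞) ^ q ∂μ ≤ B) (n : ℕ) :
    ∃ b : ℝ, ∀ t, 0 ≤ t → ∫ ω, (1 + ‖X t ω‖) ^ n ∂μ ≤ b := by
  rcases Nat.eq_zero_or_pos n with rfl | hn
  · exact ⟨1, fun t _ => by simp⟩
  obtain ⟨B, hB, hBt⟩ := hmom n (by exact_mod_cast hn)
  refine ⟨2 ^ (n - 1) * (1 + B.toReal), fun t ht => ?_⟩
  have hall : HasAllMoments (fun ω => ‖X t ω‖) μ := hasAllMoments_norm (hX t) fun q hq => by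
    obtain ⟨B', hB', h'⟩ := hmom q hq
    exact ne_top_of_le_ne_top hB' (h' t ht)
  have hbd : ∫ ω, ‖X t ω‖ ^ n ∂μ ≤ B.toReal := by
    rw [integral_eq_lintegral_of_nonneg_ae (Eventually.of_forall fun ω => by positivity)
      ((hX t).norm.pow_const n).aestronglyMeasurable]
    refine ENNReal.toReal_mono hB (le_trans (le_of_eq ?_) (hBt t ht))
    refine lintegral_congr fun ω => ?_
    rw [ENNReal.ofReal_pow (norm_nonneg _), ofReal_norm, ENNReal.rpow_natCast]
    rfl
  calc _ ≤ ∫ ω, 2 ^ (n - 1) * (1 + ‖X t ω‖ ^ n) ∂μ := by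
        refine integral_mono (((HasAllMoments.const 1).add hall).pow n).integrable
          (((HasAllMoments.const 1).add (hall.pow n)).integrable.const_mul _) fun ω => ?_
        have := add_pow_le zero_le_one (norm_nonneg (X t ω)) n
        rwa [one_pow] at this
    _ = 2 ^ (n - 1) * (1 + ∫ ω, ‖X t ω‖ ^ n ∂μ) := by
        rw [integral_const_mul, integral_add (integrable_const _) (hall.pow n).integrable]
        simp
    _ ≤ _ := by gcongr

/-- Moments of normalized discrete-time ergodic averages, uniformly over sampling meshes at most
`H`, sample sizes, and test functions dominated by `g`. -/
lemma IsExpMixing.exists_lintegral_average_pow_le [OpensMeasurableSpace E]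
    [IsFiniteMeasure π] {A : ℝ} {N : ℕ}
    (hmix : IsExpMixing μ X π g (fun x => A * (1 + ‖x‖) ^ N) C a)
    (hX : ∀ t, Measurable (X t)) (hA : 0 ≤ A) (hgV : ∀ x, g x ≤ A * (1 + ‖x‖) ^ N)
    (ha : 0 < a) (hC : 0 ≤ C)
    (hmom : ∀ q : ℝ, 0 < q → ∃ B : ℝ≥0∞, B ≠ ⊤ ∧ ∀ t : ℝ, 0 ≤ t →
      ∫⁻ ω, (‖X t ω‖₊ : ℝ≥0∞) ^ q ∂μ ≤ B) (H : ℝ) (k : ℕ) :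
    ∃ M : ℝ, ∀ (h : ℝ) (n : ℕ), 0 < h → h ≤ H → 0 < n → ∀ φ : E → ℝ, Measurable φ →
      (∀ y, |φ y| ≤ g y) →
      ∫⁻ ω, ‖√(n * h) * ((n : ℝ)⁻¹ * (∑ j ∈ Finset.range n, φ (X (j * h) ω)) - ∫ x, φ x ∂π)‖ₑ
        ^ (2 * k + 2) ∂μ ≤ ENNReal.ofReal M := by
  have hall : ∀ t, 0 ≤ t → HasAllMoments (fun ω => 1 + ‖X t ω‖) μ := fun t ht =>
    (HasAllMoments.const 1).add (hasAllMoments_norm (hX t) fun q hq => by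
      obtain ⟨B', hB', h'⟩ := hmom q hq
      exact ne_top_of_le_ne_top hB' (h' t ht))
  have hallV : ∀ A' t, 0 ≤ t → HasAllMoments (fun ω => A' * (1 + ‖X t ω‖) ^ N) μ := fun A' t ht =>
    (HasAllMoments.const A').mul ((hall t ht).pow N)
  set G₀ := (1 + C) * ∫ ω, A * (1 + ‖X 0 ω‖) ^ N ∂μ with hG₀
  have hG₀0 : 0 ≤ G₀ := by
    refine mul_nonneg (by linarith) (integral_nonneg fun ω => ?_)
    positivity
  obtain ⟨b, hb⟩ := exists_integral_one_add_norm_pow_le hX hmom (N * (2 * k + 2))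
  set c₀ := (A + G₀) ^ (2 * k + 2) * b with hc₀
  have hb0 : 0 ≤ b := (integral_nonneg fun ω => by positivity).trans (hb 0 le_rfl)
  have hc₀0 : 0 ≤ c₀ := by positivity
  refine ⟨2 * c₀ * (2 * ((2 * k + 2) ^ 2 * 4 ^ k * ((2 * k + 2) * C / a + H))) ^ (k + 1), ?_⟩
  intro h n hh hhH hn φ hφ hφg
  have hn0 : (0 : ℝ) < n := by exact_mod_cast hn
  obtain ⟨hφπ, hφabs⟩ := hmix.integrable_and_integral_abs_le hX hgV (hallV A 0 le_rfl).integrable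
    hφ hφg
  set c := ∫ x, φ x ∂π with hc
  have hcG : |c| ≤ G₀ := abs_integral_le_integral_abs.trans hφabs
  have hjh : ∀ j : ℕ, 0 ≤ (j : ℝ) * h := fun j => by positivity
  set Y : ℕ → Ω → ℝ := fun j ω => φ (X (j * h) ω) - c with hY
  set G : ℕ → Ω → ℝ := fun j ω => (A + G₀) * (1 + ‖X ((j : ℝ) * h) ω‖) ^ N with hG
  have hφX : ∀ j : ℕ, HasAllMoments (fun ω => φ (X (j * h) ω)) μ := fun j =>
    (hallV A _ (hjh j)).mono (hφ.comp (hX _)).aestronglyMeasurable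
      fun ω => (hφg _).trans (hgV _)
  have hYall : ∀ j, HasAllMoments (Y j) μ := fun j => (hφX j).sub (HasAllMoments.const c)
  have hVG : ∀ (j : ℕ) ω, A * (1 + ‖X ((j : ℝ) * h) ω‖) ^ N ≤ G j ω := fun j ω => by
    simp only [hG]; gcongr; exact le_add_of_nonneg_right hG₀0
  have hYG : ∀ j ω, |Y j ω| ≤ G j ω := by
    intro j ω
    have h1 : 1 ≤ (1 + ‖X ((j : ℝ) * h) ω‖) ^ N :=
      one_le_pow₀ (by linarith [norm_nonneg (X (j * h) ω)])
    calc |φ (X (j * h) ω) - c| ≤ |φ (X (j * h) ω)| + |c| := abs_sub _ _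
      _ ≤ A * (1 + ‖X ((j : ℝ) * h) ω‖) ^ N + G₀ * (1 + ‖X ((j : ℝ) * h) ω‖) ^ N := by
          refine add_le_add ((hφg _).trans (hgV _)) (hcG.trans ?_)
          exact le_mul_of_one_le_right hG₀0 h1
      _ = G j ω := by simp only [hG]; ring
  have hGc : ∀ j, ∫ ω, G j ω ^ (2 * k + 2) ∂μ ≤ c₀ := by
    intro j
    simp only [hG, mul_pow, ← pow_mul]
    rw [integral_const_mul]
    have := hb _ (hjh j)
    rw [hc₀]
    gcongr
  have hSm : ∀ i i' : ℕ, i ≤ i' + 1 → StronglyMeasurable[⨆ u ∈ Set.Icc (0 : ℝ) (i' * h),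
      MeasurableSpace.comap (X u) inferInstance] fun ω => ∑ l ∈ Finset.range i, Y l ω := by
    intro i i' hii
    refine Finset.stronglyMeasurable_fun_sum _ fun l hl => ?_
    rw [Finset.mem_range] at hl
    refine (Measurable.stronglyMeasurable ?_).sub stronglyMeasurable_const
    have hl' : (l : ℝ) ≤ i' := by exact_mod_cast (by omega : l ≤ i')
    have hle : MeasurableSpace.comap (X (l * h)) inferInstance ≤
        ⨆ u ∈ Set.Icc (0 : ℝ) (i' * h), MeasurableSpace.comap (X u) inferInstance :=
      le_iSup₂ (f := fun u (_ : u ∈ Set.Icc (0 : ℝ) (i' * h)) =>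
        MeasurableSpace.comap (X u) inferInstance) _ ⟨hjh l, by gcongr⟩
    exact hφ.comp ((comap_measurable (X (l * h))).mono hle le_rfl)
  have hmoment := integral_sum_pow_le (μ := μ) (C := C) (b := a * h) hC (by positivity) k hYall
    (fun j => hallV _ _ (hjh j)) hYG hGc (fun i j hij => by
      have hWall : HasAllMoments (fun ω => (∑ l ∈ Finset.range (i + 1), Y l ω) ^ (2 * k + 1)
          - (∑ l ∈ Finset.range i, Y l ω) ^ (2 * k + 1)) μ :=
        ((HasAllMoments.sum _ fun l _ => hYall l).pow _).sub
          ((HasAllMoments.sum _ fun l _ => hYall l).pow _)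
      have hWs : StronglyMeasurable[⨆ u ∈ Set.Icc (0 : ℝ) (i * h),
          MeasurableSpace.comap (X u) inferInstance] (fun ω =>
            (∑ l ∈ Finset.range (i + 1), Y l ω) ^ (2 * k + 1)
              - (∑ l ∈ Finset.range i, Y l ω) ^ (2 * k + 1)) :=
        ((hSm (i + 1) i le_rfl).pow (2 * k + 1)).sub ((hSm i i (by omega)).pow (2 * k + 1))
      have hij' : (i : ℝ) * h ≤ j * h := by gcongr
      have key := hmix.abs_integral_mul_sub_le hX hφ hφg hφπ (hjh i) hij'
        (W := fun ω => (∑ l ∈ Finset.range (i + 1), Y l ω) ^ (2 * k + 1)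
          - (∑ l ∈ Finset.range i, Y l ω) ^ (2 * k + 1)) hWs hWall (hφX j) (hallV A _ (hjh i))
      have e : -a * ((j : ℝ) * h - i * h) = -(a * h) * (j - i) := by ring
      rw [e] at key
      refine key.trans ?_
      refine mul_le_mul_of_nonneg_left (integral_mono
        (hWall.abs.mul (hallV A _ (hjh i))).integrable
        (hWall.abs.mul (hallV (A + G₀) _ (hjh i))).integrable fun ω => ?_) (by positivity)
      exact mul_le_mul_of_nonneg_left (hVG i ω) (abs_nonneg _)) n hn
  have hZ : ∀ ω, √(n * h) * ((n : ℝ)⁻¹ * (∑ j ∈ Finset.range n, φ (X (j * h) ω)) - c)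
      = √(n * h) * (n : ℝ)⁻¹ * ∑ j ∈ Finset.range n, Y j ω := by
    intro ω
    simp only [hY, Finset.sum_sub_distrib, Finset.sum_const, Finset.card_range, nsmul_eq_mul]
    field_simp
  have hsq : (√(n * h) * (n : ℝ)⁻¹) ^ (2 * k + 2) = (h / n) ^ (k + 1) := by
    rw [show 2 * k + 2 = 2 * (k + 1) by ring, pow_mul, mul_pow, Real.sq_sqrt (by positivity)]
    congr 1
    field_simp
  have hZall : HasAllMoments
      (fun ω => √(n * h) * (n : ℝ)⁻¹ * ∑ j ∈ Finset.range n, Y j ω) μ :=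
    (HasAllMoments.const _).mul (HasAllMoments.sum _ fun l _ => hYall l)
  have heven : Even (2 * k + 2) := ⟨k + 1, by ring⟩
  simp_rw [hZ]
  have e : ∀ ω, ‖√(n * h) * (n : ℝ)⁻¹ * ∑ j ∈ Finset.range n, Y j ω‖ₑ ^ (2 * k + 2)
      = ENNReal.ofReal ((√(n * h) * (n : ℝ)⁻¹ * ∑ j ∈ Finset.range n, Y j ω) ^ (2 * k + 2)) := by
    intro ω
    rw [Real.enorm_eq_ofReal_abs, ← ENNReal.ofReal_pow (abs_nonneg _), heven.pow_abs]
  simp_rw [e]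
  rw [← ofReal_integral_eq_lintegral_ofReal (hZall.pow _).integrable
    (Eventually.of_forall fun ω => heven.pow_nonneg _)]
  refine ENNReal.ofReal_le_ofReal ?_
  simp_rw [mul_pow (√(n * h) * (n : ℝ)⁻¹), hsq]
  rw [integral_const_mul]
  calc _ ≤ (h / n) ^ (k + 1) * (2 * c₀ * (2 * (n * ((2 * k + 2) ^ 2 * 4 ^ k
          * ((2 * k + 2) * C / (a * h) + 1)))) ^ (k + 1)) := by gcongr
    _ = 2 * c₀ * ((h / n) * (2 * (n * ((2 * k + 2) ^ 2 * 4 ^ k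
          * ((2 * k + 2) * C / (a * h) + 1))))) ^ (k + 1) := by rw [mul_pow (h / n)]; ring
    _ = 2 * c₀ * (2 * ((2 * k + 2) ^ 2 * 4 ^ k * ((2 * k + 2) * C / a + h))) ^ (k + 1) := by
        congr 2
        field_simp
    _ ≤ _ := by gcongr

end Ergodic

lemma ennreal_rpow_le_one_add_pow {z : ℝ≥0∞} {K : ℝ} {q : ℕ} (hK : 0 ≤ K) (hKq : K ≤ q) :
    z ^ K ≤ 1 + z ^ q := by
  rcases le_total z 1 with hz | hz
  · exact (ENNReal.rpow_le_one hz hK).trans le_self_add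
  · rw [← ENNReal.rpow_natCast z q]
    exact (ENNReal.rpow_le_rpow_of_exponent_le hz hKq).trans le_add_self

/-- uniform-in-θ moment bounds for the normalized discrete ergodic averages
(Lemma on uniform ergodic moment estimates). -/
theorem stmt8
    (d p : ℕ) (Θ : Set (EuclideanSpace ℝ (Fin p)))
    (hΘo : IsOpen Θ) (hΘb : Bornology.IsBounded Θ) (hΘconv : Convex ℝ Θ) (hΘne : Θ.Nonempty)
    (Ω : Type) [MeasurableSpace Ω] (P₀ : Measure Ω) [IsProbabilityMeasure P₀]
    (X : ℝ → Ω → EuclideanSpace ℝ (Fin d)) (hXmeas : Measurable (Function.uncurry X))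
    (P : ℝ → EuclideanSpace ℝ (Fin d) → Measure (EuclideanSpace ℝ (Fin d)))
    (hPprob : ∀ t x, IsProbabilityMeasure (P t x))
    -- Markov property: E₀[h(X_{s+t}) | σ(X_u : 0 ≤ u ≤ s)] = ∫ h(y) P_t(X_s, dy) a.s.
    (hMarkov : ∀ s t : ℝ, 0 ≤ s → 0 ≤ t →
      ∀ hfun : EuclideanSpace ℝ (Fin d) → ℝ, Measurable hfun → (∃ c, ∀ y, |hfun y| ≤ c) →
      P₀[(fun ω => hfun (X (s + t) ω)) |
          ⨆ u ∈ Set.Icc (0:ℝ) s, MeasurableSpace.comap (X u) inferInstance]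
        =ᵐ[P₀] fun ω => ∫ y, hfun y ∂ P t (X s ω))
    (h T : ℕ → ℝ) (hh : ∀ n, 0 < h n) (hTdef : ∀ n, T n = n * h n)
    (hTtop : Tendsto T atTop atTop)
    (hnh2 : Tendsto (fun n : ℕ => (n : ℝ) * h n ^ 2) atTop (𝓝 0))
    (f : EuclideanSpace ℝ (Fin d) → EuclideanSpace ℝ (Fin p) → ℝ)
    (hfmeas : Measurable (Function.uncurry f))
    (hfdiff : ∀ x, DifferentiableOn ℝ (f x) Θ)
    -- g(x) = sup_{θ∈Θ} ( |f(x,θ)| ∨ |∂_θ f(x,θ)| ), of at most polynomial growth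
    (g : EuclideanSpace ℝ (Fin d) → ℝ)
    (hgdef : ∀ x, IsLUB
      (Set.range fun θ : Θ => max |f x θ.1| ‖fderivWithin ℝ (f x) Θ θ.1‖) (g x))
    (hgpoly : ∃ Cg γ : ℝ, 0 ≤ Cg ∧ 0 ≤ γ ∧ ∀ x, g x ≤ Cg * (1 + ‖x‖) ^ γ)
    (π₀ : Measure (EuclideanSpace ℝ (Fin d))) [IsProbabilityMeasure π₀]
    (a C : ℝ) (ha : 0 < a) (hC : 0 < C)
    -- ‖P_t(x,·) − π₀‖_g ≲ e^{−at} g(x), via test functions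
    (hergo : ∀ t : ℝ, 0 ≤ t → ∀ x, ∀ hfun : EuclideanSpace ℝ (Fin d) → ℝ, Measurable hfun →
      (∀ y, |hfun y| ≤ g y) →
      |(∫ y, hfun y ∂ P t x) - ∫ y, hfun y ∂ π₀| ≤ C * Real.exp (-a * t) * g x)
    -- sup_{t≥0} E₀[|X_t|^q] < ∞ for every q > 0
    (hmom : ∀ q : ℝ, 0 < q → ∃ B : ℝ≥0∞, B ≠ ⊤ ∧ ∀ t : ℝ, 0 ≤ t →
      ∫⁻ ω, (‖X t ω‖₊ : ℝ≥0∞) ^ q ∂ P₀ ≤ B) :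
    ∀ K : ℝ, 0 < K → ∃ B : ℝ≥0∞, B ≠ ⊤ ∧ ∀ n : ℕ,
      ∫⁻ ω, ⨆ θ ∈ Θ, (ENNReal.ofReal
          |Real.sqrt (T n) * ((n : ℝ)⁻¹ * (∑ j ∈ Finset.range n, f (X ((j : ℝ) * h n) ω) θ) -
            ∫ x, f x θ ∂ π₀)|) ^ K ∂ P₀ ≤ B := by
  intro K hK
  have hX : ∀ t, Measurable (X t) := fun t => hXmeas.comp measurable_prodMk_left
  obtain ⟨Cg, γ, hCg, -, hgγ⟩ := hgpoly
  set N := ⌈γ⌉₊ with hN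
  have hgV : ∀ x, g x ≤ Cg * (1 + ‖x‖) ^ N := fun x => by
    refine (hgγ x).trans ?_
    rw [← Real.rpow_natCast]
    gcongr
    · linarith [norm_nonneg x]
    · exact Nat.le_ceil γ
  have hmix : IsExpMixing P₀ X π₀ g (fun x => Cg * (1 + ‖x‖) ^ N) C a := by
    intro s t hs ht φ hφ hφb hφg
    filter_upwards [hMarkov s t hs ht φ hφ hφb] with ω hω
    rw [hω]
    refine (hergo t ht (X s ω) φ hφ hφg).trans ?_
    gcongr
    exact hgV _
  have hfg : ∀ θ ∈ Θ, ∀ x, |f x θ| ≤ g x := fun θ hθ x =>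
    (le_max_left _ _).trans ((hgdef x).1 ⟨⟨θ, hθ⟩, rfl⟩)
  have hg0 : ∀ x, 0 ≤ g x := fun x => by
    obtain ⟨θ, hθ⟩ := hΘne
    exact (abs_nonneg _).trans (hfg θ hθ x)
  have hflip : ∀ θ ∈ Θ, ∀ θ' ∈ Θ, ∀ x, |f x θ - f x θ'| ≤ g x * ‖θ - θ'‖ :=
    fun θ hθ θ' hθ' x => hΘconv.norm_image_sub_le_of_norm_fderivWithin_le (𝕜 := ℝ) (hfdiff x)
      (fun η hη => (le_max_right _ _).trans ((hgdef x).1 ⟨⟨η, hη⟩, rfl⟩)) hθ' hθ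
  have hfm : ∀ θ, Measurable fun x => f x θ := fun θ => hfmeas.comp measurable_prodMk_right
  have hV0 : Integrable (fun ω => Cg * (1 + ‖X 0 ω‖) ^ N) P₀ :=
    ((HasAllMoments.const Cg).mul (((HasAllMoments.const 1).add
      (hasAllMoments_norm (hX 0) fun q hq => by
        obtain ⟨B, hB, hBt⟩ := hmom q hq
        exact ne_top_of_le_ne_top hB (hBt 0 le_rfl))).pow N)).integrable
  have hπ := fun φ => hmix.integrable_and_integral_abs_le (φ := φ) hX hgV hV0
  have hfi : ∀ θ ∈ Θ, Integrable (fun x => f x θ) π₀ := fun θ hθ => (hπ _ (hfm θ) (hfg θ hθ)).1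
  -- Difference quotients in the parameter are again test functions dominated by `g`.
  have hquot : ∀ θ ∈ Θ, ∀ θ' ∈ Θ, ∃ φ : EuclideanSpace ℝ (Fin d) → ℝ, Measurable φ ∧
      (∀ x, |φ x| ≤ g x) ∧ ∀ x, f x θ - f x θ' = ‖θ - θ'‖ * φ x := by
    intro θ hθ θ' hθ'
    refine ⟨fun x => (f x θ - f x θ') / ‖θ - θ'‖, ((hfm θ).sub (hfm θ')).div_const _,
      fun x => ?_, fun x => ?_⟩
    · rw [abs_div, abs_norm]
      exact div_le_of_le_mul₀ (norm_nonneg _) (hg0 x) (hflip θ hθ θ' hθ' x)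
    · rcases eq_or_ne θ θ' with rfl | hne
      · simp
      · field_simp [norm_ne_zero_iff.2 (sub_ne_zero.2 hne)]
  have hintcont : ContinuousOn (fun θ => ∫ x, f x θ ∂π₀) Θ := by
    set G₀ := (1 + C) * ∫ ω, Cg * (1 + ‖X 0 ω‖) ^ N ∂P₀ with hG₀
    refine (LipschitzOnWith.of_dist_le_mul (K := G₀.toNNReal) fun θ hθ θ' hθ' => ?_).continuousOn
    obtain ⟨φ, hφ, hφg, hφe⟩ := hquot θ hθ θ' hθ'
    rw [dist_eq_norm, dist_eq_norm, ← integral_sub (hfi θ hθ) (hfi θ' hθ'),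
      integral_congr_ae (Eventually.of_forall hφe), integral_const_mul, norm_mul, norm_norm,
      mul_comm]
    gcongr
    exact (abs_integral_le_integral_abs.trans (hπ φ hφ hφg).2).trans (Real.le_coe_toNNReal _)
  obtain ⟨b, hb⟩ := hnh2.bddAbove_range
  have hhb : ∀ n : ℕ, 0 < n → h n ≤ 1 + b := by
    intro n hn
    have h1 : (n : ℝ) * h n ^ 2 ≤ b := hb ⟨n, rfl⟩
    have h2 : (1 : ℝ) ≤ n := by exact_mod_cast hn
    nlinarith [sq_nonneg (h n - 1), sq_nonneg (h n)]
  set k := p + ⌈K⌉₊ with hk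
  have hKq : K ≤ (2 * k + 2 : ℕ) := by
    refine (Nat.le_ceil K).trans ?_
    exact_mod_cast (by omega)
  obtain ⟨M, hM⟩ := hmix.exists_lintegral_average_pow_le hX hCg hgV ha hC.le hmom (1 + b) k
  obtain ⟨B, hB, hchain⟩ := exists_lintegral_iSup_enorm_pow_le hΘb hΘne
    (q := 2 * k + 2) (by omega)
  refine ⟨1 + B * ENNReal.ofReal M, by finiteness, fun n => ?_⟩
  rcases Nat.eq_zero_or_pos n with rfl | hn
  · simp [hTdef, ENNReal.zero_rpow_of_pos hK]
  have hT : T n = n * h n := hTdef n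
  set Z : EuclideanSpace ℝ (Fin p) → Ω → ℝ := fun θ ω => √(n * h n) *
    ((n : ℝ)⁻¹ * (∑ j ∈ Finset.range n, f (X ((j : ℝ) * h n) ω) θ) - ∫ x, f x θ ∂π₀) with hZ
  have hZint : ∫⁻ ω, ⨆ θ ∈ Θ, ‖Z θ ω‖ₑ ^ (2 * k + 2) ∂P₀ ≤ B * ENNReal.ofReal M := by
    refine hchain P₀ Z _ (fun θ _ => ?_) (fun ω => ?_) (fun θ hθ => ?_) fun θ hθ θ' hθ' => ?_
    · exact (((Finset.measurable_fun_sum _ fun j _ => (hfm θ).comp (hX _)).const_mul _).sub_const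
        _).const_mul _
    · exact (((continuousOn_finsetSum _ fun j _ => (hfdiff _).continuousOn).const_mul _).sub
        hintcont).const_mul _
    · exact hM (h n) n (hh n) (hhb n hn) hn (fun x => f x θ) (hfm θ) (hfg θ hθ)
    · obtain ⟨φ, hφ, hφg, hφe⟩ := hquot θ hθ θ' hθ'
      have hZφ : ∀ ω, Z θ ω - Z θ' ω = ‖θ - θ'‖ * (√(n * h n) * ((n : ℝ)⁻¹ *
          (∑ j ∈ Finset.range n, φ (X ((j : ℝ) * h n) ω)) - ∫ x, φ x ∂π₀)) := by
        intro ω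
        have e1 : ∑ j ∈ Finset.range n, f (X ((j : ℝ) * h n) ω) θ
            - ∑ j ∈ Finset.range n, f (X ((j : ℝ) * h n) ω) θ'
            = ‖θ - θ'‖ * ∑ j ∈ Finset.range n, φ (X ((j : ℝ) * h n) ω) := by
          rw [← Finset.sum_sub_distrib, Finset.mul_sum]
          exact Finset.sum_congr rfl fun j _ => hφe _
        have e2 : ∫ x, f x θ ∂π₀ - ∫ x, f x θ' ∂π₀ = ‖θ - θ'‖ * ∫ x, φ x ∂π₀ := by
          rw [← integral_sub (hfi θ hθ) (hfi θ' hθ'), ← integral_const_mul]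
          exact integral_congr_ae (Eventually.of_forall hφe)
        simp only [hZ]
        linear_combination √(n * h n) * (n : ℝ)⁻¹ * e1 - √(n * h n) * e2
      simp_rw [hZφ, enorm_mul, mul_pow, enorm_norm]
      rw [lintegral_const_mul' _ _ (by finiteness), mul_comm]
      gcongr
      simpa only [enorm_mul, mul_pow] using hM (h n) n (hh n) (hhb n hn) hn φ hφ hφg
  calc _ ≤ ∫⁻ ω, 1 + ⨆ θ ∈ Θ, ‖Z θ ω‖ₑ ^ (2 * k + 2) ∂P₀ := by
        refine lintegral_mono fun ω => iSup₂_le fun θ hθ => ?_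
        rw [hT, ← Real.enorm_eq_ofReal_abs]
        refine (ennreal_rpow_le_one_add_pow hK.le hKq).trans ?_
        gcongr
        exact le_iSup₂ (f := fun θ (_ : θ ∈ Θ) => ‖Z θ ω‖ₑ ^ (2 * k + 2)) θ hθ
    _ ≤ 1 + B * ENNReal.ofReal M := by
        rw [lintegral_add_left measurable_const]
        simpa using hZint
end

section
/- Suppose c(x) ≠ 0 for every x ∈ ℝ. Then condition (S) holds if and only if ν({z : 0 ≤ c(x)z ≤ δ}) > 0 and ν({z : −δ ≤ c(x)z ≤ 0}) > 0 for every x ∈ ℝ and every δ > 0. In particular, if in addition there exists ε̄ > 0 such that ν((−ε, 0)) > 0 and ν((0, ε)) > 0 for every ε ∈ (0, ε̄), then condition (S) holds (and for each x and v one may take ρ = 0). -/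
open MeasureTheory
open scoped ENNReal

/-- For `ρ > -1`, every point of the one-dimensional cone `{y | ρ * |y| ≤ y}` is nonnegative. -/
lemma nonneg_of_mul_abs_le {ρ y : ℝ} (hρ : -1 < ρ) (h : ρ * |y| ≤ y) : 0 ≤ y := by
  by_contra! hy
  rw [abs_of_neg hy] at h
  nlinarith

/-- A scaling by `a` maps small intervals into small symmetric intervals. -/
lemma exists_pos_lt_forall_abs_mul_le (a : ℝ) {r δ : ℝ} (hr : 0 < r) (hδ : 0 < δ) :
    ∃ ε ∈ Set.Ioo (0 : ℝ) r, ∀ z : ℝ, |z| ≤ ε → |a * z| ≤ δ := by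
  have ha : 0 < |a| + 1 := by positivity
  refine ⟨min (r / 2) (δ / (|a| + 1)), ⟨by positivity, ?_⟩, fun z hz => ?_⟩
  · exact (min_le_left _ _).trans_lt (half_lt_self hr)
  · have h : |z| * (|a| + 1) ≤ δ := (le_div_iff₀ ha).1 (hz.trans (min_le_right _ _))
    rw [abs_mul]
    nlinarith [abs_nonneg z]

/-- characterization of Kulik's condition (S) when `c` never vanishes. -/
theorem stmt11
    (ν : Measure ℝ) [SigmaFinite ν] (hν0 : ν {0} = 0)
    (c : ℝ → ℝ) (hc : ∀ x, c x ≠ 0) :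
    (((∀ x : ℝ, ∀ v ∈ ({-1, 1} : Set ℝ), ∃ ρ ∈ Set.Ioo (-1 : ℝ) 1, ∀ δ : ℝ, 0 < δ →
        0 < ν {z : ℝ | c x * z ∈ {y : ℝ | y * v ≥ ρ * |y|} ∩ {y : ℝ | |y| ≤ δ}}) ↔
      (∀ x : ℝ, ∀ δ : ℝ, 0 < δ →
        0 < ν {z : ℝ | 0 ≤ c x * z ∧ c x * z ≤ δ} ∧
        0 < ν {z : ℝ | -δ ≤ c x * z ∧ c x * z ≤ 0})) ∧
     ((∃ εbar : ℝ, 0 < εbar ∧ ∀ ε ∈ Set.Ioo (0:ℝ) εbar,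
          0 < ν (Set.Ioo (-ε) 0) ∧ 0 < ν (Set.Ioo 0 ε)) →
       ∀ x : ℝ, ∀ v ∈ ({-1, 1} : Set ℝ), ∀ δ : ℝ, 0 < δ →
        0 < ν {z : ℝ | c x * z ∈ {y : ℝ | y * v ≥ (0:ℝ) * |y|} ∩ {y : ℝ | |y| ≤ δ}})) := by
  refine ⟨⟨fun h x δ hδ => ⟨?_, ?_⟩, fun h x v hv => ⟨0, by norm_num, fun δ hδ => ?_⟩⟩, ?_⟩
  · obtain ⟨ρ, hρ, H⟩ := h x 1 (by simp)
    refine (H δ hδ).trans_le (measure_mono ?_)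
    rintro z ⟨hz, hzδ⟩
    simp only [Set.mem_ofPred_eq, mul_one, ge_iff_le] at hz hzδ
    exact ⟨nonneg_of_mul_abs_le hρ.1 hz, (abs_le.1 hzδ).2⟩
  · obtain ⟨ρ, hρ, H⟩ := h x (-1) (by simp)
    refine (H δ hδ).trans_le (measure_mono ?_)
    rintro z ⟨hz, hzδ⟩
    simp only [Set.mem_ofPred_eq, mul_neg_one, ge_iff_le] at hz hzδ
    rw [← abs_neg] at hz
    exact ⟨(abs_le.1 hzδ).1, neg_nonneg.1 (nonneg_of_mul_abs_le hρ.1 hz)⟩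
  · obtain rfl | rfl := hv
    · refine (h x δ hδ).2.trans_le (measure_mono ?_)
      rintro z ⟨h1, h2⟩
      exact ⟨by simpa using h2, abs_le.2 ⟨h1, h2.trans hδ.le⟩⟩
    · refine (h x δ hδ).1.trans_le (measure_mono ?_)
      rintro z ⟨h1, h2⟩
      exact ⟨by simpa using h1, abs_le.2 ⟨(neg_nonpos.2 hδ.le).trans h1, h2⟩⟩
  · rintro ⟨r, hr, H⟩ x v hv δ hδ
    obtain ⟨ε, hε, hsmall⟩ := exists_pos_lt_forall_abs_mul_le (c x) hr hδ
    obtain ⟨hneg, hpos⟩ := H ε hε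
    have hv0 : v ≠ 0 := by
      obtain rfl | rfl := hv <;> norm_num
    obtain hcv | hcv := (mul_ne_zero (hc x) hv0).lt_or_gt
    · refine hneg.trans_le (measure_mono fun z hz => ⟨?_, ?_⟩)
      · simp only [Set.mem_ofPred_eq, zero_mul, ge_iff_le]
        nlinarith [hz.2]
      · exact hsmall z (abs_le.2 ⟨hz.1.le, hz.2.le.trans hε.1.le⟩)
    · refine hpos.trans_le (measure_mono fun z hz => ⟨?_, ?_⟩)
      · simp only [Set.mem_ofPred_eq, zero_mul, ge_iff_le]
        nlinarith [hz.1]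
      · exact hsmall z (abs_le.2 ⟨(neg_neg_of_pos hε.1).le.trans hz.1.le, hz.2.le⟩)
end

section
/- Suppose ∫ z² e^{q|z|} ν(dz) < ∞ for some q > 0, that b and c are bounded, and that there exist constants A > 0 and R₀ > 0 with sgn(x)·a(x) ≤ −A for all |x| ≥ R₀ (so that limsup_{|x|→∞} sgn(x)a(x) < 0). Fix C > 0. Then there exists ε₀ ∈ (0, min(q/‖c‖_∞, 1)) such that for every ε ∈ (0, ε₀) and every positive φ ∈ C²(ℝ) satisfying φ(x) = e^{ε|x|} for |x| ≥ ε^{−1}, φ(x) ≤ e^{ε|x|} for all x, and |φ''(x)| ≤ C ε² φ(x) for all x, there exist constants c₀ > 0 and R > 0 such that for every x with |x| ≥ R, φ'(x)a(x) + (1/2)φ''(x)b(x)² + ∫ ( φ(x + c(x)z) − φ(x) − φ'(x)c(x)z ) ν(dz) ≤ −c₀ φ(x). -/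
open MeasureTheory

/-- First-order Taylor remainder bound from a bound on the second derivative on a ball. -/
theorem abs_sub_sub_deriv_mul_le {f : ℝ → ℝ} (hf : ContDiff ℝ 2 f) {x h M : ℝ}
    (hM : ∀ y, |y - x| ≤ |h| → |deriv (deriv f) y| ≤ M) :
    |f (x + h) - f x - deriv f x * h| ≤ M * h ^ 2 := by
  have hf1 : Differentiable ℝ f := hf.differentiable (by norm_num)
  have hf2 : Differentiable ℝ (deriv f) :=
    (ContDiff.deriv' (n := 1) (by simpa [one_add_one_eq_two] using hf)).differentiable (by norm_num)
  have hM0 : 0 ≤ M := (abs_nonneg _).trans (hM x (by simp))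
  have hconv : Convex ℝ (Metric.closedBall x |h|) := convex_closedBall x |h|
  have hx : x ∈ Metric.closedBall x |h| := Metric.mem_closedBall_self (abs_nonneg h)
  have hderiv : ∀ y ∈ Metric.closedBall x |h|, ‖deriv f y - deriv f x‖ ≤ M * |h| := by
    intro y hy
    refine (hconv.norm_image_sub_le_of_norm_deriv_le (fun z _ => hf2 z)
      (fun z hz => hM z hz) hx hy).trans ?_
    exact mul_le_mul_of_nonneg_left hy hM0
  have hg : ∀ y, HasDerivAt (fun y => f y - deriv f x * y) (deriv f y - deriv f x) y := fun y => by
    simpa using (hf1 y).hasDerivAt.fun_sub ((hasDerivAt_id' y).const_mul (deriv f x))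
  have key := hconv.norm_image_sub_le_of_norm_hasDerivWithin_le
    (fun y _ => (hg y).hasDerivWithinAt) hderiv hx
    (show x + h ∈ Metric.closedBall x |h| by simp [Metric.mem_closedBall])
  have hsq : |h| * |h| = h ^ 2 := by rw [← sq, sq_abs]
  calc |f (x + h) - f x - deriv f x * h|
      = ‖f (x + h) - deriv f x * (x + h) - (f x - deriv f x * x)‖ := by
        rw [Real.norm_eq_abs]; congr 1; ring
    _ ≤ M * |h| * ‖x + h - x‖ := key
    _ = M * h ^ 2 := by rw [add_sub_cancel_left, Real.norm_eq_abs, mul_assoc, hsq]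

theorem deriv_eq_of_eq_exp_mul_abs {φ : ℝ → ℝ} {ε r x : ℝ}
    (hφ : ∀ x, r ≤ |x| → φ x = Real.exp (ε * |x|)) (hx0 : x ≠ 0) (hx : r < |x|) :
    deriv φ x = ε * Real.sign x * φ x := by
  have hev : φ =ᶠ[nhds x] fun y => Real.exp (ε * |y|) := by
    filter_upwards [continuous_abs.continuousAt.eventually (lt_mem_nhds hx)] with y hy
    exact hφ y hy.le
  rw [hev.deriv_eq, hev.eq_of_nhds]
  rcases hx0.lt_or_gt with hneg | hpos
  · rw [((hasDerivAt_abs_neg hneg).const_mul ε).exp.deriv, Real.sign_of_neg hneg]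
    ring
  · rw [((hasDerivAt_abs_pos hpos).const_mul ε).exp.deriv, Real.sign_of_pos hpos]
    ring

/-- The jump part of the generator applied to a function with exponential growth. -/
theorem integral_jump_le {ν : Measure ℝ} {φ : ℝ → ℝ} (hφ : ContDiff ℝ 2 φ) {ε q C B c x : ℝ}
    (hε : 0 ≤ ε) (hC : 0 ≤ C) (hc : |c| ≤ B) (hεq : ε * B ≤ q)
    (hKint : Integrable (fun z => z ^ 2 * Real.exp (q * |z|)) ν)
    (hle : ∀ y, φ y ≤ Real.exp (ε * |y|))
    (hφ2 : ∀ y, |deriv (deriv φ) y| ≤ C * ε ^ 2 * φ y) :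
    ∫ z, (φ (x + c * z) - φ x - deriv φ x * (c * z)) ∂ν ≤
      C * ε ^ 2 * Real.exp (ε * |x|) * B ^ 2 * ∫ z, z ^ 2 * Real.exp (q * |z|) ∂ν := by
  rw [← integral_const_mul]
  refine (Real.le_norm_self _).trans
    (norm_integral_le_of_norm_le (hKint.const_mul _) (Filter.Eventually.of_forall fun z => ?_))
  have hcz : |c * z| ≤ B * |z| := by
    rw [abs_mul]; exact mul_le_mul_of_nonneg_right hc (abs_nonneg z)
  have hexp : ε * |c * z| ≤ q * |z| :=
    calc ε * |c * z| ≤ ε * (B * |z|) := mul_le_mul_of_nonneg_left hcz hε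
      _ = ε * B * |z| := by ring
      _ ≤ q * |z| := mul_le_mul_of_nonneg_right hεq (abs_nonneg z)
  have hrem := abs_sub_sub_deriv_mul_le hφ (x := x) (h := c * z)
    (M := C * ε ^ 2 * (Real.exp (ε * |x|) * Real.exp (q * |z|))) fun y hy => by
      refine (hφ2 y).trans (mul_le_mul_of_nonneg_left ((hle y).trans ?_) (by positivity))
      rw [← Real.exp_add]
      refine Real.exp_le_exp.2 ?_
      have hy' : |y| ≤ |x| + |c * z| := by
        have := abs_sub_abs_le_abs_sub y x
        linarith
      nlinarith [mul_le_mul_of_nonneg_left hy' hε]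
  have hsq : (c * z) ^ 2 ≤ B ^ 2 * z ^ 2 := by
    rw [mul_pow]
    exact mul_le_mul_of_nonneg_right (sq_le_sq.2 (hc.trans (le_abs_self B))) (sq_nonneg z)
  calc ‖φ (x + c * z) - φ x - deriv φ x * (c * z)‖
      ≤ C * ε ^ 2 * (Real.exp (ε * |x|) * Real.exp (q * |z|)) * (c * z) ^ 2 := hrem
    _ ≤ C * ε ^ 2 * (Real.exp (ε * |x|) * Real.exp (q * |z|)) * (B ^ 2 * z ^ 2) :=
        mul_le_mul_of_nonneg_left hsq (by positivity)
    _ = C * ε ^ 2 * Real.exp (ε * |x|) * B ^ 2 * (z ^ 2 * Real.exp (q * |z|)) := by ring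

/-- exponential Lyapunov drift condition under the drift assumption A-E3(ii). -/
theorem stmt13
    (ν : Measure ℝ) (a b c : ℝ → ℝ)
    (hameas : Measurable a) (hbmeas : Measurable b) (hcmeas : Measurable c)
    (Bb Bc : ℝ) (hBb : IsLUB (Set.range fun x => |b x|) Bb)
    (hBc : IsLUB (Set.range fun x => |c x|) Bc) (hBc0 : 0 < Bc)
    (q : ℝ) (hq : 0 < q)
    (hKint : Integrable (fun z => z ^ 2 * Real.exp (q * |z|)) ν)
    (A R₀ : ℝ) (hA : 0 < A) (hR₀ : 0 < R₀)
    (hdrift : ∀ x : ℝ, R₀ ≤ |x| → Real.sign x * a x ≤ -A)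
    (C : ℝ) (hC : 0 < C) :
    ∃ ε₀ ∈ Set.Ioo (0:ℝ) (min (q / Bc) 1), ∀ ε ∈ Set.Ioo (0:ℝ) ε₀,
      ∀ φ : ℝ → ℝ, ContDiff ℝ 2 φ → (∀ x, 0 < φ x) →
        (∀ x : ℝ, ε⁻¹ ≤ |x| → φ x = Real.exp (ε * |x|)) →
        (∀ x, φ x ≤ Real.exp (ε * |x|)) →
        (∀ x, |deriv (deriv φ) x| ≤ C * ε ^ 2 * φ x) →
        ∃ c₀ : ℝ, 0 < c₀ ∧ ∃ R : ℝ, 0 < R ∧ ∀ x : ℝ, R ≤ |x| →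
          deriv φ x * a x + 1 / 2 * deriv (deriv φ) x * (b x) ^ 2 +
              (∫ z, (φ (x + c x * z) - φ x - deriv φ x * (c x * z)) ∂ ν) ≤
            -c₀ * φ x := by
  have hb : ∀ x, |b x| ≤ Bb := fun x => hBb.1 ⟨x, rfl⟩
  have hc : ∀ x, |c x| ≤ Bc := fun x => hBc.1 ⟨x, rfl⟩
  set K := ∫ z, z ^ 2 * Real.exp (q * |z|) ∂ν with hK
  have hK0 : 0 ≤ K := integral_nonneg fun z => by positivity
  set S := Bb ^ 2 + Bc ^ 2 * K with hS
  have hS0 : 0 ≤ S := by positivity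
  have hm : 0 < min (q / Bc) 1 := lt_min (div_pos hq hBc0) one_pos
  have hd : 0 < A / (2 * C * (S + 1)) := by positivity
  refine ⟨min (min (q / Bc) 1 / 2) (A / (2 * C * (S + 1))),
    ⟨lt_min (half_pos hm) hd, (min_le_left _ _).trans_lt (half_lt_self hm)⟩, ?_⟩
  rintro ε ⟨hε, hεlt⟩ φ hφ hpos hφeq hle hφ2
  have hεq : ε * Bc ≤ q := by
    rw [← le_div_iff₀ hBc0]
    exact (hεlt.trans_le ((min_le_left _ _).trans
      ((half_le_self hm.le).trans (min_le_left _ _)))).le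
  have hεA : C * ε * S ≤ A / 2 := by
    have h1 := (lt_div_iff₀ (by positivity)).1 (hεlt.trans_le (min_le_right _ _))
    nlinarith [mul_pos hε hC]
  refine ⟨ε * A / 2, by positivity, max R₀ (ε⁻¹ + 1), lt_max_of_lt_left hR₀, fun x hx => ?_⟩
  have hxR : R₀ ≤ |x| := (le_max_left _ _).trans hx
  have hxε : ε⁻¹ < |x| := (lt_add_one _).trans_le ((le_max_right _ _).trans hx)
  have hx0 : x ≠ 0 := abs_pos.1 (hR₀.trans_le hxR)
  have hdriftφ : deriv φ x * a x ≤ -A * ε * φ x := by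
    rw [deriv_eq_of_eq_exp_mul_abs hφeq hx0 hxε]
    nlinarith [mul_le_mul_of_nonneg_left (hdrift x hxR) (mul_pos hε (hpos x)).le]
  have hdiff : 1 / 2 * deriv (deriv φ) x * (b x) ^ 2 ≤ C * ε ^ 2 * φ x * Bb ^ 2 := by
    have hb2 : (b x) ^ 2 ≤ Bb ^ 2 := sq_le_sq.2 ((hb x).trans (le_abs_self _))
    have hφ0 : 0 ≤ C * ε ^ 2 * φ x := (abs_nonneg _).trans (hφ2 x)
    calc 1 / 2 * deriv (deriv φ) x * (b x) ^ 2 ≤ C * ε ^ 2 * φ x * (b x) ^ 2 :=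
          mul_le_mul_of_nonneg_right
            (by linarith [(le_abs_self _).trans (hφ2 x)]) (sq_nonneg _)
      _ ≤ C * ε ^ 2 * φ x * Bb ^ 2 := mul_le_mul_of_nonneg_left hb2 hφ0
  have hjump := integral_jump_le hφ (x := x) hε.le hC.le (hc x) hεq hKint hle hφ2
  rw [← hφeq x hxε.le, ← hK] at hjump
  have hfin : C * ε * S * (ε * φ x) ≤ A / 2 * (ε * φ x) :=
    mul_le_mul_of_nonneg_right hεA (mul_pos hε (hpos x)).le
  have hsplit : C * ε * S * (ε * φ x) =
      C * ε ^ 2 * φ x * Bb ^ 2 + C * ε ^ 2 * φ x * Bc ^ 2 * K := by rw [hS]; ring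
  linarith
end
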